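/- (Estimate (3.14).) Let N ≥ 2 and N ≤ p < 2N − 1. There exists C > 0, depending only on N, p and the Littlewood–Paley function, such that for every u ∈ C_c^∞((0,∞)×ℝ^N; ℝ^N), the divergence correction V₅(u) := ∑_{i,j=1}^N P_{ji} ∂_j u_i satisfies ‖∇V₅(u)‖_{L¹(ℝ₊;Ḃ^{−1+N/p}_{p,1}(ℝ^N))} ≤ C ∑_{r=2}^{N} E(u)^r. -/

import Mathlib

open MeasureTheory
open scoped BigOperators ENNReal

noncomputable section

namespace MHD

/-- A Littlewood–Paley function on a finite-dimensional real inner product space: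
a nonnegative, smooth, radial, radially nonincreasing function equal to `1` on the unit
ball and supported in the ball of radius `2`. -/
structure LPF (V : Type*) [NormedAddCommGroup V] [InnerProductSpace ℝ V]
    [FiniteDimensional ℝ V] [MeasurableSpace V] [BorelSpace V] where
  chi : V → ℝ
  smooth : ContDiff ℝ (⊤ : ℕ∞) chi
  nonneg : ∀ x, 0 ≤ chi x
  radial : ∀ x y : V, ‖x‖ = ‖y‖ → chi x = chi y
  radial_antitone : ∀ x y : V, ‖x‖ ≤ ‖y‖ → chi y ≤ chi x
  eq_one : ∀ x : V, ‖x‖ ≤ 1 → chi x = 1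
  supp : ∀ x : V, 2 ≤ ‖x‖ → chi x = 0

variable {V : Type*} [NormedAddCommGroup V] [InnerProductSpace ℝ V]
    [FiniteDimensional ℝ V] [MeasurableSpace V] [BorelSpace V]

/-- `φ̂(ξ) = χ̂(ξ/2) − χ̂(ξ)`. -/
def LPF.phiHat (χ : LPF V) (ξ : V) : ℝ := χ.chi ((2 : ℝ)⁻¹ • ξ) - χ.chi ξ

/-- The `k`-th homogeneous Littlewood–Paley block `Δ̇_k f = 𝓕⁻¹(φ̂(2^{-k}·)·𝓕f)`. -/
def LPF.block (χ : LPF V) (k : ℤ) (f : V → ℂ) : V → ℂ :=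
  FourierTransformInv.fourierInv
    (fun ξ : V => ((χ.phiHat ((2 : ℝ) ^ (-k) • ξ) : ℝ) : ℂ) * FourierTransform.fourier f ξ)

/-- The `k`-th Littlewood–Paley kernel `𝓕⁻¹(φ̂(2^{-k}·))`. -/
def LPF.kernel (χ : LPF V) (k : ℤ) : V → ℂ :=
  FourierTransformInv.fourierInv (fun ξ : V => ((χ.phiHat ((2 : ℝ) ^ (-k) • ξ) : ℝ) : ℂ))

/-- The homogeneous Besov norm `‖f‖_{Ḃ^s_{p,1}} = ∑_{k∈ℤ} 2^{sk} ‖Δ̇_k f‖_{L^p} ∈ [0,∞]`. -/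
def besov (χ : LPF V) (s p : ℝ) (f : V → ℂ) : ℝ≥0∞ :=
  ∑' k : ℤ, ENNReal.ofReal ((2 : ℝ) ^ (s * (k : ℝ))) *
    eLpNorm (χ.block k f) (ENNReal.ofReal p) volume

/-- The space-time norm `∫_I ‖u(t,·)‖_{Ḃ^s_{p,1}} dt ∈ [0,∞]`. -/
def besovT (χ : LPF V) (s p : ℝ) (I : Set ℝ) (u : ℝ → V → ℂ) : ℝ≥0∞ :=
  ∫⁻ t in I, besov χ s p (u t)

/-- Euclidean space `ℝ^n`. -/
abbrev Euc (n : ℕ) := EuclideanSpace ℝ (Fin n)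

/-- Partial derivative `∂_i f` in the `i`-th coordinate direction. -/
def pdv {n : ℕ} {F : Type*} [NormedAddCommGroup F] [NormedSpace ℝ F]
    (i : Fin n) (f : Euc n → F) (y : Euc n) : F :=
  fderiv ℝ f y (EuclideanSpace.single i 1)

/-- `u ∈ C_c^∞((0,∞) × ℝ^N ; F)`. -/
def SmoothCpt (N : ℕ) {F : Type*} [NormedAddCommGroup F] [NormedSpace ℝ F]
    (u : ℝ → Euc N → F) : Prop :=
  ContDiff ℝ (⊤ : ℕ∞) (Function.uncurry u) ∧ HasCompactSupport (Function.uncurry u) ∧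
    ∀ t : ℝ, t ≤ 0 → ∀ y, u t y = 0

/-- `Q` is the family of cofactor polynomials: `Q i j` has zero constant term and
`adjugate (1 + M) i j = δ_{ij} + (Q i j)(M)` for every real `N × N` matrix `M`. -/
def IsCofactorPoly (N : ℕ) (Q : Fin N → Fin N → MvPolynomial (Fin N × Fin N) ℝ) : Prop :=
  ∀ i j : Fin N,
    MvPolynomial.constantCoeff (Q i j) = 0 ∧
    ∀ M : Matrix (Fin N) (Fin N) ℝ,
      Matrix.adjugate (1 + M) i j =
        (if i = j then (1 : ℝ) else 0) +
          MvPolynomial.eval (fun v : Fin N × Fin N => M v.1 v.2) (Q i j)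

/-- The matrix field `P_{ij}(t,y) = Q_{ij}(∫₀ᵗ Du(τ,y) dτ)`. -/
def Pmat {N : ℕ} (Q : Fin N → Fin N → MvPolynomial (Fin N × Fin N) ℝ)
    (u : ℝ → Euc N → Euc N) (t : ℝ) (y : Euc N) (i j : Fin N) : ℝ :=
  MvPolynomial.eval
    (fun v : Fin N × Fin N => ∫ τ in (0 : ℝ)..t, pdv v.2 (fun z => u τ z v.1) y) (Q i j)

/-- `E(u) = ‖D²u‖_{L¹(ℝ₊; Ḃ^s_{p,1}(ℝ^N))}`, summed over all components and all pairs of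
spatial derivatives. -/
def EE {N : ℕ} (χ : LPF (Euc N)) (s p : ℝ) (u : ℝ → Euc N → Euc N) : ℝ≥0∞ :=
  ∑ m : Fin N, ∑ i : Fin N, ∑ j : Fin N,
    besovT χ s p (Set.Ioi 0) (fun t y => ((pdv i (pdv j fun z => u t z m) y : ℝ) : ℂ))

/-- `‖∂_t u‖_{L¹(ℝ₊; Ḃ^s_{p,1}(ℝ^N))}`, summed over components. -/
def dtNorm {N : ℕ} (χ : LPF (Euc N)) (s p : ℝ) (u : ℝ → Euc N → Euc N) : ℝ≥0∞ :=
  ∑ m : Fin N,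
    besovT χ s p (Set.Ioi 0) (fun t y => ((deriv (fun τ => u τ y m) t : ℝ) : ℂ))

end MHD

open MHD

noncomputable section

namespace MHD

open FourierTransform SchwartzMap

section Minkowski

/-- Minkowski's integral inequality. -/
theorem lintegral_lintegral_rpow_le {α β : Type*} [MeasurableSpace α] [MeasurableSpace β]
    {μ : Measure α} {ν : Measure β} [SigmaFinite μ] [SFinite ν] {p : ℝ} (hp : 1 < p)
    {F : α → β → ℝ≥0∞} (hF : Measurable (Function.uncurry F)) :
    (∫⁻ y, (∫⁻ x, F x y ∂μ) ^ p ∂ν) ^ (1 / p) ≤ ∫⁻ x, (∫⁻ y, F x y ^ p ∂ν) ^ (1 / p) ∂μ := by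
  have hp0 : 0 < p := by linarith
  set q := p.conjExponent with hq
  have hpq : p.HolderConjugate q := Real.HolderConjugate.conjExponent hp
  have hq0 : 0 < q := hpq.symm.pos
  set a : α → ℝ≥0∞ := fun x => (∫⁻ y, F x y ^ p ∂ν) ^ (1 / p) with ha
  have hFm : ∀ x, Measurable (F x) := fun x => hF.comp measurable_prodMk_left
  have hFm' : ∀ y, Measurable fun x => F x y := fun y => hF.comp measurable_prodMk_right
  have ham : Measurable a := by
    refine Measurable.pow_const ?_ _
    exact (hF.pow_const p).lintegral_prod_right'
  by_cases hA : ∫⁻ x, a x ∂μ = ∞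
  · rw [hA]; exact le_top
  refine ENNReal.le_of_forall_pos_le_add fun ε hε _ => ?_
  obtain ⟨g, hg0, hgm, hg⟩ := exists_pos_lintegral_lt_of_sigmaFinite μ
    (ε := (ε : ℝ≥0∞)) (by simpa using hε.ne')
  set b : α → ℝ≥0∞ := fun x => a x + g x with hb
  have hbm : Measurable b := ham.add hgm.coe_nnreal_ennreal
  have hb0 : ∀ x, b x ≠ 0 := fun x => by simp [hb, (hg0 x).ne']
  set B := ∫⁻ x, b x ∂μ with hB
  have hBle : B ≤ ∫⁻ x, a x ∂μ + ε := by
    rw [hB, lintegral_add_left ham]; gcongr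
  have hBtop : B ≠ ∞ := ne_top_of_le_ne_top (by simp [hA]) hBle
  have hbtop : ∀ᵐ x ∂μ, b x < ∞ := ae_lt_top hbm hBtop
  refine le_trans ?_ hBle
  have hq1 : p * (1 / q) = p - 1 := by
    have := hpq.inv_add_inv_eq_one; field_simp at this ⊢; nlinarith
  have key : ∀ y, (∫⁻ x, F x y ∂μ) ^ p ≤
      B ^ (p - 1) * ∫⁻ x, F x y ^ p * b x ^ (-(p - 1)) ∂μ := by
    intro y
    have h1 : ∫⁻ x, F x y ∂μ = ∫⁻ x, b x ^ (1 / q) * (F x y * b x ^ (-(1 / q))) ∂μ := by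
      refine lintegral_congr_ae ?_
      filter_upwards [hbtop] with x hx
      rw [mul_comm (F x y), ← mul_assoc, ← ENNReal.rpow_add _ _ (hb0 x) hx.ne]
      simp
    have h2 := ENNReal.lintegral_mul_le_Lp_mul_Lq μ hpq.symm
      (f := fun x => b x ^ (1 / q)) (g := fun x => F x y * b x ^ (-(1 / q)))
      (hbm.pow_const _).aemeasurable ((hFm' y).mul (hbm.pow_const _)).aemeasurable
    have h3 : ∀ x, (b x ^ (1 / q)) ^ q = b x := fun x => by
      rw [← ENNReal.rpow_mul, one_div_mul_cancel hq0.ne', ENNReal.rpow_one]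
    have h4 : ∀ x, (F x y * b x ^ (-(1 / q))) ^ p = F x y ^ p * b x ^ (-(p - 1)) := fun x => by
      rw [ENNReal.mul_rpow_of_nonneg _ _ hp0.le, ← ENNReal.rpow_mul]
      congr 2; rw [← hq1]; ring
    simp only [Pi.mul_apply, h3, h4] at h2
    rw [← h1] at h2
    calc (∫⁻ x, F x y ∂μ) ^ p ≤ (B ^ (1 / q) *
          (∫⁻ x, F x y ^ p * b x ^ (-(p - 1)) ∂μ) ^ (1 / p)) ^ p := by gcongr
      _ = _ := by
        rw [ENNReal.mul_rpow_of_nonneg _ _ hp0.le, ← ENNReal.rpow_mul, ← ENNReal.rpow_mul,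
          one_div_mul_cancel hp0.ne', ENNReal.rpow_one, mul_comm (1 / q), hq1]
  have hmeas : Measurable (Function.uncurry fun x y => F x y ^ p * b x ^ (-(p - 1))) :=
    (hF.pow_const p).mul ((hbm.comp measurable_fst).pow_const _)
  calc (∫⁻ y, (∫⁻ x, F x y ∂μ) ^ p ∂ν) ^ (1 / p)
      ≤ (∫⁻ y, B ^ (p - 1) * ∫⁻ x, F x y ^ p * b x ^ (-(p - 1)) ∂μ ∂ν) ^ (1 / p) := by
        gcongr with y; exact key y
    _ = (B ^ (p - 1) * ∫⁻ x, ∫⁻ y, F x y ^ p * b x ^ (-(p - 1)) ∂ν ∂μ) ^ (1 / p) := by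
        rw [lintegral_const_mul' _ _ (ENNReal.rpow_ne_top_of_nonneg (by linarith) hBtop),
          lintegral_lintegral_swap hmeas.aemeasurable]
    _ ≤ (B ^ (p - 1) * B) ^ (1 / p) := by
        gcongr
        refine lintegral_mono_ae ?_
        filter_upwards [hbtop] with x hx
        rw [lintegral_mul_const _ ((hFm x).pow_const p)]
        have : ∫⁻ y, F x y ^ p ∂ν = a x ^ p := by
          rw [ha]; simp only; rw [← ENNReal.rpow_mul, one_div_mul_cancel hp0.ne', ENNReal.rpow_one]
        rw [this]
        calc a x ^ p * b x ^ (-(p - 1)) ≤ b x ^ p * b x ^ (-(p - 1)) := by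
              gcongr; simp [hb]
          _ = b x := by
            rw [← ENNReal.rpow_add _ _ (hb0 x) hx.ne]; simp
    _ = B := by
        by_cases hB0 : B = 0
        · rw [hB0, mul_zero, ENNReal.zero_rpow_of_pos (by positivity)]
        nth_rewrite 2 [← ENNReal.rpow_one B]
        rw [← ENNReal.rpow_add _ _ hB0 hBtop, ← ENNReal.rpow_mul]
        simp [hp0.ne']

theorem eLpNorm_ofReal_eq {β E : Type*} [MeasurableSpace β] [NormedAddCommGroup E]
    {ν : Measure β} {p : ℝ} (hp : 0 < p) (f : β → E) :
    eLpNorm f (ENNReal.ofReal p) ν = (∫⁻ y, ‖f y‖ₑ ^ p ∂ν) ^ (1 / p) := by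
  rw [eLpNorm_eq_lintegral_rpow_enorm_toReal (by simpa using hp) (by simp),
    ENNReal.toReal_ofReal hp.le]

theorem eLpNorm_le_lintegral_eLpNorm {α β E E' : Type*} [MeasurableSpace α] [MeasurableSpace β]
    [NormedAddCommGroup E] [NormedAddCommGroup E']
    {μ : Measure α} {ν : Measure β} [SigmaFinite μ] [SFinite ν] {p : ℝ} (hp : 1 < p)
    {F : α → β → E'} (hF : Measurable fun z : α × β => ‖F z.1 z.2‖ₑ) {G : β → E}
    (hG : ∀ y, ‖G y‖ₑ ≤ ∫⁻ x, ‖F x y‖ₑ ∂μ) :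
    eLpNorm G (ENNReal.ofReal p) ν ≤ ∫⁻ x, eLpNorm (F x) (ENNReal.ofReal p) ν ∂μ := by
  have hp0 : 0 < p := by linarith
  simp only [eLpNorm_ofReal_eq hp0]
  refine le_trans ?_ (lintegral_lintegral_rpow_le hp (F := fun x y => ‖F x y‖ₑ) hF)
  gcongr with y
  exact hG y

end Minkowski

section Multiplier

variable {V : Type*} [NormedAddCommGroup V] [InnerProductSpace ℝ V]
    [FiniteDimensional ℝ V] [MeasurableSpace V] [BorelSpace V]

/-- The Fourier multiplier with Schwartz symbol `m`. -/
def mult (m f : 𝓢(V, ℂ)) : 𝓢(V, ℂ) := fourierMultiplierCLM ℂ (m : V → ℂ) f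

theorem fourier_mult (m f : 𝓢(V, ℂ)) (ξ : V) : 𝓕 (mult m f) ξ = m ξ * 𝓕 f ξ := by
  rw [mult, fourierMultiplierCLM_apply, FourierTransform.fourier_fourierInv_eq,
    smulLeftCLM_apply_apply m.hasTemperateGrowth, smul_eq_mul]

theorem fourier_injective {f g : 𝓢(V, ℂ)} (h : ∀ ξ, 𝓕 f ξ = 𝓕 g ξ) : f = g := by
  have : 𝓕 f = 𝓕 g := SchwartzMap.ext h
  calc f = 𝓕⁻ (𝓕 f) := (FourierTransform.fourierInv_fourier_eq f).symm
    _ = 𝓕⁻ (𝓕 g) := by rw [this]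
    _ = g := FourierTransform.fourierInv_fourier_eq g

theorem mult_coe (m f : 𝓢(V, ℂ)) : (mult m f : V → ℂ) = 𝓕⁻ (fun ξ => m ξ * 𝓕 (f : V → ℂ) ξ) := by
  rw [mult, fourierMultiplierCLM_apply, fourierInv_coe]
  congr 1
  ext ξ
  rw [smulLeftCLM_apply_apply m.hasTemperateGrowth, smul_eq_mul, fourier_coe]

theorem mult_mult {a b c : 𝓢(V, ℂ)} (h : ∀ ξ, a ξ * b ξ = c ξ) (f : 𝓢(V, ℂ)) :
    mult a (mult b f) = mult c f := by
  refine fourier_injective fun ξ => ?_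
  rw [fourier_mult, fourier_mult, fourier_mult, ← h, mul_assoc]

theorem mult_apply (m f : 𝓢(V, ℂ)) (x : V) : mult m f x = ∫ z, (𝓕⁻ m) z * f (x - z) := by
  have : mult m f = SchwartzMap.convolution (ContinuousLinearMap.mul ℂ ℂ) (𝓕⁻ m) f := by
    refine fourier_injective fun ξ => ?_
    rw [fourier_mult, fourier_convolution, FourierTransform.fourier_fourierInv_eq]
    rfl
  rw [this, SchwartzMap.convolution_apply]
  rfl

theorem enorm_mult_le (m f : 𝓢(V, ℂ)) (x : V) :
    ‖mult m f x‖ₑ ≤ ∫⁻ z, ‖(𝓕⁻ m) z * f (x - z)‖ₑ := by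
  rw [mult_apply]; exact enorm_integral_le_lintegral_enorm _

/-- Young's inequality for multipliers. -/
theorem eLpNorm_mult_le {p : ℝ} (hp : 1 < p) (m f : 𝓢(V, ℂ)) :
    eLpNorm (mult m f) (ENNReal.ofReal p) volume ≤
      (∫⁻ z, ‖(𝓕⁻ m) z‖ₑ) * eLpNorm f (ENNReal.ofReal p) volume := by
  have h0 : Measurable fun z : V × V => ‖(𝓕⁻ m) z.1 * f (z.2 - z.1)‖ₑ :=
    (((𝓕⁻ m).continuous.comp continuous_fst).mul
      (f.continuous.comp (continuous_snd.sub continuous_fst))).measurable.enorm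
  have hle := enorm_mult_le m f
  generalize (𝓕⁻ m) = K at *
  have hK : Measurable fun z => ‖K z‖ₑ := K.continuous.measurable.enorm
  refine (eLpNorm_le_lintegral_eLpNorm (μ := volume) hp
    (F := fun z x => K z * f (x - z)) h0 hle).trans ?_
  rw [← lintegral_mul_const _ hK]
  refine lintegral_mono fun z => ?_
  have : (fun x => K z * f (x - z)) = K z • fun x => f (x - z) := rfl
  rw [this, eLpNorm_const_smul]
  gcongr
  exact (eLpNorm_comp_measurePreserving f.continuous.aestronglyMeasurable
    (measurePreserving_sub_right volume z)).le

/-- Bernstein's inequality for multipliers. -/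
theorem enorm_mult_le_eLpNorm {p q : ℝ} (hpq : p.HolderConjugate q) (m f : 𝓢(V, ℂ)) (x : V) :
    ‖mult m f x‖ₑ ≤ (∫⁻ z, ‖(𝓕⁻ m) z‖ₑ ^ q) ^ (1 / q) * eLpNorm f (ENNReal.ofReal p) volume := by
  refine (enorm_mult_le m f x).trans ?_
  simp only [enorm_mul]
  have h1 : Measurable fun z => ‖(𝓕⁻ m) z‖ₑ := (𝓕⁻ m).continuous.measurable.enorm
  have h2 : Measurable fun z => ‖f (x - z)‖ₑ :=
    (f.continuous.comp (continuous_const.sub continuous_id)).measurable.enorm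
  refine (ENNReal.lintegral_mul_le_Lp_mul_Lq volume hpq.symm h1.aemeasurable
    h2.aemeasurable).trans ?_
  rw [eLpNorm_ofReal_eq hpq.pos]
  have : ∫⁻ z, ‖f (x - z)‖ₑ ^ p = ∫⁻ z, ‖f z‖ₑ ^ p :=
    lintegral_sub_left_eq_self (fun z => ‖f z‖ₑ ^ p) x
  rw [this]

end Multiplier

end MHD

namespace MHD

open FourierTransform SchwartzMap

set_option linter.unusedSectionVars false

section Dilation

variable {V : Type*} [NormedAddCommGroup V] [InnerProductSpace ℝ V]
    [FiniteDimensional ℝ V] [MeasurableSpace V] [BorelSpace V]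

/-- The dilated symbol `ξ ↦ m (2^{-k} ξ)`. -/
def dil (k : ℤ) (m : 𝓢(V, ℂ)) : 𝓢(V, ℂ) :=
  compCLMOfContinuousLinearEquiv ℂ
    (ContinuousLinearEquiv.smulLeft (Units.mk0 ((2 : ℝ) ^ (-k)) (by positivity)) : V ≃L[ℝ] V) m

theorem dil_apply (k : ℤ) (m : 𝓢(V, ℂ)) (ξ : V) : dil k m ξ = m ((2 : ℝ) ^ (-k) • ξ) := rfl

theorem fourierInv_dil (k : ℤ) (m : 𝓢(V, ℂ)) (x : V) :
    𝓕⁻ (dil k m) x =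
      (((2 : ℝ) ^ (k * Module.finrank ℝ V) : ℝ) : ℂ) * 𝓕⁻ m ((2 : ℝ) ^ k • x) := by
  rw [fourierInv_coe, fourierInv_coe, Real.fourierInv_eq', Real.fourierInv_eq']
  have h := Measure.integral_comp_smul_of_nonneg (volume : Measure V)
    (fun v => Complex.exp (((2 * Real.pi * inner ℝ v ((2 : ℝ) ^ k • x) : ℝ) : ℂ) * Complex.I) • m v)
    ((2 : ℝ) ^ (-k)) (hR := by positivity)
  rw [← zpow_natCast, ← zpow_mul, ← zpow_neg, neg_mul, neg_neg] at h
  rw [← Complex.real_smul, ← h]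
  congr 1
  ext v
  rw [dil_apply, inner_smul_left, inner_smul_right]
  have h2 : (2 : ℝ) ^ k ≠ 0 := by positivity
  simp [zpow_neg, h2]

theorem ofReal_two_rpow (x : ℝ) : ENNReal.ofReal ((2 : ℝ) ^ x) = (2 : ℝ≥0∞) ^ x := by
  rw [← ENNReal.ofReal_rpow_of_pos two_pos]; simp

theorem two_rpow_mul_two_rpow (x y : ℝ) : (2 : ℝ≥0∞) ^ x * 2 ^ y = 2 ^ (x + y) :=
  (ENNReal.rpow_add x y (by simp) (by simp)).symm

theorem two_rpow_ne_top (x : ℝ) : (2 : ℝ≥0∞) ^ x ≠ ∞ := by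
  rw [← ofReal_two_rpow]; exact ENNReal.ofReal_ne_top

theorem lintegral_comp_two_zpow_smul {g : V → ℝ≥0∞} (hg : Measurable g) (k : ℤ) :
    ∫⁻ x, g ((2 : ℝ) ^ k • x) = 2 ^ (-(k * Module.finrank ℝ V : ℝ)) * ∫⁻ x, g x := by
  rw [← lintegral_map hg (measurable_const_smul _),
    Measure.map_addHaar_smul _ (by positivity : (2 : ℝ) ^ k ≠ 0), lintegral_smul_measure,
    ← ofReal_two_rpow, smul_eq_mul]
  congr 2
  rw [abs_of_nonneg (by positivity), Real.rpow_neg two_pos.le, ← zpow_natCast, ← zpow_mul,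
    ← Real.rpow_intCast]
  push_cast
  rfl

theorem enorm_fourierInv_dil (k : ℤ) (m : 𝓢(V, ℂ)) (x : V) :
    ‖𝓕⁻ (dil k m) x‖ₑ =
      2 ^ (k * Module.finrank ℝ V : ℝ) * ‖𝓕⁻ m ((2 : ℝ) ^ k • x)‖ₑ := by
  rw [fourierInv_dil, enorm_mul, ← ofReal_two_rpow]
  congr 1
  rw [← ofReal_norm, Complex.norm_real, Real.norm_of_nonneg (by positivity),
    ← Real.rpow_intCast]
  push_cast
  rfl

theorem lintegral_enorm_fourierInv_dil (k : ℤ) (m : 𝓢(V, ℂ)) :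
    ∫⁻ x, ‖𝓕⁻ (dil k m) x‖ₑ = ∫⁻ x, ‖𝓕⁻ m x‖ₑ := by
  have hK : Measurable fun z => ‖(𝓕⁻ m) z‖ₑ := (𝓕⁻ m).continuous.measurable.enorm
  simp only [enorm_fourierInv_dil]
  rw [lintegral_const_mul' _ _ (two_rpow_ne_top _), lintegral_comp_two_zpow_smul hK, ← mul_assoc,
    two_rpow_mul_two_rpow]
  simp

theorem lintegral_enorm_rpow_fourierInv_dil {p q : ℝ} (hpq : p.HolderConjugate q) (k : ℤ)
    (m : 𝓢(V, ℂ)) :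
    (∫⁻ x, ‖𝓕⁻ (dil k m) x‖ₑ ^ q) ^ (1 / q) =
      2 ^ (Module.finrank ℝ V / p * k : ℝ) * (∫⁻ x, ‖𝓕⁻ m x‖ₑ ^ q) ^ (1 / q) := by
  have hq := hpq.symm.pos
  have hp := hpq.pos
  have hK : Measurable fun z => ‖(𝓕⁻ m) z‖ₑ ^ q :=
    (𝓕⁻ m).continuous.measurable.enorm.pow_const _
  simp only [enorm_fourierInv_dil, ENNReal.mul_rpow_of_nonneg _ _ hq.le]
  rw [lintegral_const_mul' _ _ (ENNReal.rpow_ne_top_of_nonneg hq.le (two_rpow_ne_top _)),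
    lintegral_comp_two_zpow_smul hK, ← mul_assoc, ← ENNReal.rpow_mul, two_rpow_mul_two_rpow,
    ENNReal.mul_rpow_of_nonneg _ _ (by positivity), ← ENNReal.rpow_mul]
  congr 2
  have h1 : 1 - q⁻¹ = p⁻¹ := hpq.symm.one_sub_inv
  rw [div_eq_mul_inv _ p, ← h1]
  field_simp
  ring

theorem lintegral_enorm_rpow_lt_top {q : ℝ} (hq : 0 < q) (K : 𝓢(V, ℂ)) :
    (∫⁻ x, ‖K x‖ₑ ^ q) ^ (1 / q) < ∞ := by
  have h := K.eLpNorm_lt_top (ENNReal.ofReal q) volume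
  rwa [eLpNorm_ofReal_eq hq] at h

theorem lintegral_enorm_lt_top (K : 𝓢(V, ℂ)) : ∫⁻ x, ‖K x‖ₑ < ∞ := by
  simpa using lintegral_enorm_rpow_lt_top one_pos K

end Dilation

section Blocks

variable {V : Type*} [NormedAddCommGroup V] [InnerProductSpace ℝ V]
    [FiniteDimensional ℝ V] [MeasurableSpace V] [BorelSpace V]

theorem hasCompactSupport_of_forall_le {f : V → ℂ} {R : ℝ} (h : ∀ x, R ≤ ‖x‖ → f x = 0) :
    HasCompactSupport f := by
  refine HasCompactSupport.intro (isCompact_closedBall (0 : V) R) fun x hx => h x ?_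
  rw [mem_closedBall_zero_iff, not_le] at hx
  exact hx.le

/-- The function `χ̂` as a Schwartz symbol. -/
def LPF.low (χ : LPF V) : 𝓢(V, ℂ) :=
  HasCompactSupport.toSchwartzMap (f := fun ξ => (χ.chi ξ : ℂ))
    (hasCompactSupport_of_forall_le (R := 2) fun x hx => by simp [χ.supp x hx])
    (Complex.ofRealCLM.contDiff.comp χ.smooth)

theorem LPF.low_apply (χ : LPF V) (ξ : V) : χ.low ξ = χ.chi ξ := rfl

/-- The function `φ̂` as a Schwartz symbol. -/
def LPF.band (χ : LPF V) : 𝓢(V, ℂ) := dil 1 χ.low - χ.low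

theorem LPF.band_apply (χ : LPF V) (ξ : V) : χ.band ξ = χ.phiHat ξ := by
  simp [LPF.band, dil_apply, LPF.low_apply, LPF.phiHat]

theorem LPF.phiHat_eq_zero_of_le_one (χ : LPF V) {ξ : V} (h : ‖ξ‖ ≤ 1) : χ.phiHat ξ = 0 := by
  rw [LPF.phiHat, χ.eq_one ξ h, χ.eq_one, sub_self]
  rw [norm_smul]; norm_num; linarith

theorem LPF.phiHat_eq_zero_of_four_le (χ : LPF V) {ξ : V} (h : 4 ≤ ‖ξ‖) : χ.phiHat ξ = 0 := by
  rw [LPF.phiHat, χ.supp ξ (by linarith), χ.supp, sub_self]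
  rw [norm_smul]; norm_num; linarith

theorem LPF.chi_le_one (χ : LPF V) (ξ : V) : χ.chi ξ ≤ 1 := by
  rw [← χ.eq_one 0 (by simp)]
  exact χ.radial_antitone _ _ (by simp)

/-- The Littlewood–Paley block on Schwartz functions. -/
def LPF.lp (χ : LPF V) (k : ℤ) (f : 𝓢(V, ℂ)) : 𝓢(V, ℂ) := mult (dil k χ.band) f

/-- The low-frequency cut-off on Schwartz functions. -/
def LPF.cut (χ : LPF V) (k : ℤ) (f : 𝓢(V, ℂ)) : 𝓢(V, ℂ) := mult (dil k χ.low) f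

theorem LPF.block_coe (χ : LPF V) (k : ℤ) (f : 𝓢(V, ℂ)) : χ.block k f = χ.lp k f := by
  rw [LPF.block, LPF.lp, mult_coe]
  simp only [dil_apply, LPF.band_apply]

theorem LPF.cut_add_one (χ : LPF V) (k : ℤ) (f : 𝓢(V, ℂ)) :
    χ.cut (k + 1) f = χ.cut k f + χ.lp k f := by
  refine fourier_injective fun ξ => ?_
  rw [FourierTransform.fourier_add, add_apply, LPF.cut, LPF.cut, LPF.lp, fourier_mult,
    fourier_mult, fourier_mult, LPF.band, dil_apply, dil_apply, dil_apply, sub_apply,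
    dil_apply, smul_smul, ← zpow_add₀ two_ne_zero, neg_add_rev]
  ring

theorem LPF.cut_lp (χ : LPF V) (k : ℤ) (f : 𝓢(V, ℂ)) : χ.cut (k + 2) (χ.lp k f) = χ.lp k f := by
  refine mult_mult (fun ξ => ?_) f
  rw [dil_apply, dil_apply, LPF.band_apply, LPF.low_apply]
  by_cases h : 4 ≤ ‖(2 : ℝ) ^ (-k) • ξ‖
  · rw [χ.phiHat_eq_zero_of_four_le h]; simp
  · rw [χ.eq_one, Complex.ofReal_one, one_mul]
    push Not at h
    rw [norm_smul, norm_zpow, Real.norm_ofNat] at h ⊢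
    rw [neg_add, zpow_add₀ two_ne_zero]
    have : (2 : ℝ) ^ (-2 : ℤ) = 1 / 4 := by norm_num
    rw [this]
    linarith

theorem besov_coe (χ : LPF V) (s p : ℝ) (f : 𝓢(V, ℂ)) :
    besov χ s p f = ∑' k : ℤ, 2 ^ (s * k) * eLpNorm (χ.lp k f) (ENNReal.ofReal p) volume := by
  simp only [besov, LPF.block_coe, ofReal_two_rpow]

end Blocks

end MHD

namespace MHD

open FourierTransform SchwartzMap Filter Topology

set_option linter.unusedSectionVars false

section Products

variable {V : Type*} [NormedAddCommGroup V] [InnerProductSpace ℝ V]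
    [FiniteDimensional ℝ V] [MeasurableSpace V] [BorelSpace V]

/-- Pointwise product of Schwartz functions. -/
def prd (f g : 𝓢(V, ℂ)) : 𝓢(V, ℂ) := SchwartzMap.pairing (ContinuousLinearMap.mul ℂ ℂ) f g

theorem prd_apply (f g : 𝓢(V, ℂ)) (x : V) : prd f g x = f x * g x := rfl

theorem fourier_prd (f g : 𝓢(V, ℂ)) (ξ : V) : 𝓕 (prd f g) ξ = ∫ η, 𝓕 f η * 𝓕 g (ξ - η) := by
  set a := 𝓕 f
  set b := 𝓕 g
  have key : prd f g = 𝓕⁻ (SchwartzMap.convolution (ContinuousLinearMap.mul ℂ ℂ) a b) := by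
    ext x
    have hf : f x = 𝓕 a (-x) := by
      have h := DFunLike.congr_fun (fourierInv_apply_eq a) x
      rwa [FourierTransform.fourierInv_fourier_eq] at h
    have hg : g x = 𝓕 b (-x) := by
      have h := DFunLike.congr_fun (fourierInv_apply_eq b) x
      rwa [FourierTransform.fourierInv_fourier_eq] at h
    rw [fourierInv_apply_eq, SchwartzMap.fourier_convolution, prd_apply, hf, hg]
    rfl
  rw [key, FourierTransform.fourier_fourierInv_eq, SchwartzMap.convolution_apply]
  rfl

theorem fourier_prd_eq_zero {f g : 𝓢(V, ℂ)} {R S : ℝ} (hf : ∀ ξ, R ≤ ‖ξ‖ → 𝓕 f ξ = 0)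
    (hg : ∀ ξ, S ≤ ‖ξ‖ → 𝓕 g ξ = 0) (ξ : V) (hξ : R + S ≤ ‖ξ‖) : 𝓕 (prd f g) ξ = 0 := by
  rw [fourier_prd]
  refine integral_eq_zero_of_ae (Eventually.of_forall fun η => ?_)
  by_cases h : R ≤ ‖η‖
  · simp [hf η h]
  · have := norm_sub_norm_le ξ η
    simp [hg (ξ - η) (by linarith)]

theorem eLpNorm_prd_le {p : ℝ} (f g : 𝓢(V, ℂ)) {A : ℝ≥0∞} (hA : ∀ x, ‖f x‖ₑ ≤ A) (hp : 0 < p) :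
    eLpNorm (prd f g) (ENNReal.ofReal p) volume ≤ A * eLpNorm g (ENNReal.ofReal p) volume := by
  by_cases hT : A = ∞
  · by_cases h0 : eLpNorm g (ENNReal.ofReal p) volume = 0
    · rw [eLpNorm_eq_zero_iff g.continuous.aestronglyMeasurable (by simpa using hp)] at h0
      have : (prd f g : V → ℂ) =ᵐ[volume] 0 := by
        filter_upwards [h0] with x hx
        simp [prd_apply, hx]
      rw [eLpNorm_congr_ae this]; simp
    · rw [hT, ENNReal.top_mul h0]; exact le_top
  · lift A to NNReal using hT
    refine (eLpNorm_le_nnreal_smul_eLpNorm_of_ae_le_mul (c := A)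
      (Eventually.of_forall fun x => ?_) _).trans_eq rfl
    rw [prd_apply, nnnorm_mul]
    gcongr
    exact_mod_cast hA x

theorem LPF.fourier_cut_eq_zero (χ : LPF V) (k : ℤ) (f : 𝓢(V, ℂ)) (ξ : V)
    (h : (2 : ℝ) ^ (k + 1) ≤ ‖ξ‖) : 𝓕 (χ.cut k f) ξ = 0 := by
  rw [LPF.cut, fourier_mult, dil_apply, LPF.low_apply, χ.supp]
  · simp
  rw [norm_smul, norm_zpow, Real.norm_ofNat]
  calc (2 : ℝ) = 2 ^ (-k) * 2 ^ (k + 1) := by rw [← zpow_add₀ two_ne_zero]; simp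
    _ ≤ _ := by gcongr

theorem LPF.fourier_lp_eq_zero (χ : LPF V) (k : ℤ) (f : 𝓢(V, ℂ)) (ξ : V)
    (h : (2 : ℝ) ^ (k + 2) ≤ ‖ξ‖) : 𝓕 (χ.lp k f) ξ = 0 := by
  rw [LPF.lp, fourier_mult, dil_apply, LPF.band_apply, χ.phiHat_eq_zero_of_four_le]
  · simp
  rw [norm_smul, norm_zpow, Real.norm_ofNat]
  calc (4 : ℝ) = 2 ^ (-k) * 2 ^ (k + 2) := by rw [← zpow_add₀ two_ne_zero]; norm_num
    _ ≤ _ := by gcongr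

theorem LPF.lp_eq_zero (χ : LPF V) (k : ℤ) (f : 𝓢(V, ℂ))
    (h : ∀ ξ, (2 : ℝ) ^ k ≤ ‖ξ‖ → 𝓕 f ξ = 0) : χ.lp k f = 0 := by
  refine fourier_injective fun ξ => ?_
  have h0 : 𝓕 (0 : 𝓢(V, ℂ)) ξ = 0 := by
    have : (0 : 𝓢(V, ℂ)) = mult 0 0 := by ext x; rw [mult_apply]; simp
    rw [this, fourier_mult]; simp
  rw [h0, LPF.lp, fourier_mult, dil_apply, LPF.band_apply]
  by_cases hξ : (2 : ℝ) ^ k ≤ ‖ξ‖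
  · rw [h ξ hξ, mul_zero]
  · rw [χ.phiHat_eq_zero_of_le_one]
    · simp
    rw [norm_smul, norm_zpow, Real.norm_ofNat]
    calc (2 : ℝ) ^ (-k) * ‖ξ‖ ≤ 2 ^ (-k) * 2 ^ k := by gcongr; exact (not_le.mp hξ).le
      _ = 1 := by rw [← zpow_add₀ two_ne_zero]; simp

theorem LPF.lp_prd_cut_lp (χ : LPF V) {q k : ℤ} (h : k + 3 ≤ q) (f g : 𝓢(V, ℂ)) :
    χ.lp q (prd (χ.cut (k + 1) f) (χ.lp k g)) = 0 := by
  refine χ.lp_eq_zero q _ fun ξ hξ => ?_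
  refine fourier_prd_eq_zero (χ.fourier_cut_eq_zero (k + 1) f) (χ.fourier_lp_eq_zero k g) ξ
    (le_trans ?_ hξ)
  calc (2 : ℝ) ^ (k + 1 + 1) + 2 ^ (k + 2) = 2 ^ (k + 3) := by
        rw [zpow_add₀ two_ne_zero k 3, zpow_add₀ two_ne_zero k 2, add_assoc,
          zpow_add₀ two_ne_zero k]
        norm_num; ring
    _ ≤ 2 ^ q := zpow_le_zpow_right₀ (by norm_num) h

theorem LPF.lp_prd_cut_lp' (χ : LPF V) {q k : ℤ} (h : k + 3 ≤ q) (f g : 𝓢(V, ℂ)) :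
    χ.lp q (prd (χ.cut k f) (χ.lp k g)) = 0 := by
  refine χ.lp_eq_zero q _ fun ξ hξ => ?_
  refine fourier_prd_eq_zero (χ.fourier_cut_eq_zero k f) (χ.fourier_lp_eq_zero k g) ξ
    (le_trans ?_ hξ)
  calc (2 : ℝ) ^ (k + 1) + 2 ^ (k + 2) ≤ 2 ^ (k + 3) := by
        rw [zpow_add₀ two_ne_zero k 3, zpow_add₀ two_ne_zero k 2, zpow_add₀ two_ne_zero k 1]
        have : (0 : ℝ) < 2 ^ k := by positivity
        norm_num; linarith
    _ ≤ 2 ^ q := zpow_le_zpow_right₀ (by norm_num) h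

theorem tendsto_mult {m : ℕ → 𝓢(V, ℂ)} {c : ℂ} (h1 : ∀ n ξ, ‖m n ξ‖ ≤ 1)
    (h2 : ∀ᵐ ξ, Tendsto (fun n => m n ξ) atTop (𝓝 c)) (f : 𝓢(V, ℂ)) (x : V) :
    Tendsto (fun n => mult (m n) f x) atTop (𝓝 (c * f x)) := by
  have h3 : ∀ (g : V → ℂ), c * 𝓕⁻ g x = 𝓕⁻ (fun ξ => c * g ξ) x := fun g => by
    rw [Real.fourierInv_eq', Real.fourierInv_eq', ← integral_const_mul]
    congr 1; ext v; simp only [smul_eq_mul]; ring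
  have h4 : f x = 𝓕⁻ (𝓕 f : 𝓢(V, ℂ)) x := by rw [FourierTransform.fourierInv_fourier_eq]
  rw [h4, fourierInv_coe, h3]
  simp only [mult_coe, ← fourier_coe, Real.fourierInv_eq']
  refine tendsto_integral_of_dominated_convergence (fun ξ => ‖𝓕 f ξ‖) (fun n => ?_)
    (𝓕 f).integrable.norm (fun n => Eventually.of_forall fun ξ => ?_) ?_
  · refine Continuous.aestronglyMeasurable ?_
    have e1 := (m n).continuous
    have e2 := (𝓕 f).continuous
    simp only [smul_eq_mul]
    refine Continuous.mul ?_ (e1.mul e2)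
    fun_prop
  · rw [norm_smul, Complex.norm_exp_ofReal_mul_I, one_mul, norm_mul]
    exact mul_le_of_le_one_left (norm_nonneg _) (h1 n ξ)
  · filter_upwards [h2] with ξ hξ
    exact (hξ.mul_const (𝓕 f ξ)).const_mul _

theorem LPF.norm_dil_low_le (χ : LPF V) (k : ℤ) (ξ : V) : ‖dil k χ.low ξ‖ ≤ 1 := by
  rw [dil_apply, LPF.low_apply, Complex.norm_real, Real.norm_of_nonneg (χ.nonneg _)]
  exact χ.chi_le_one _

theorem LPF.tendsto_cut (χ : LPF V) (f : 𝓢(V, ℂ)) (x : V) :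
    Tendsto (fun n : ℕ => χ.cut n f x) atTop (𝓝 (f x)) := by
  have := tendsto_mult (m := fun n : ℕ => dil n χ.low) (c := 1)
    (fun n => χ.norm_dil_low_le n) (Eventually.of_forall fun ξ => ?_) f x
  · simpa [LPF.cut] using this
  have h : Tendsto (fun n : ℕ => (2 : ℝ) ^ (-(n : ℤ)) • ξ) atTop (𝓝 ((0 : ℝ) • ξ)) := by
    refine Tendsto.smul_const ?_ _
    simp only [zpow_neg, zpow_natCast, ← inv_pow]
    exact tendsto_pow_atTop_nhds_zero_of_lt_one (by norm_num) (by norm_num)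
  have h2 := (χ.low.continuous.tendsto _).comp h
  have h3 : χ.low ((0 : ℝ) • ξ) = 1 := by rw [LPF.low_apply, χ.eq_one] <;> simp
  rwa [h3] at h2

theorem LPF.tendsto_cut_neg [Nontrivial V] (χ : LPF V) (f : 𝓢(V, ℂ)) (j : ℤ) (x : V) :
    Tendsto (fun n : ℕ => χ.cut (j - n) f x) atTop (𝓝 0) := by
  have := tendsto_mult (m := fun n : ℕ => dil (j - n) χ.low) (c := 0)
    (fun n => χ.norm_dil_low_le _) ?_ f x
  · simpa [LPF.cut] using this
  filter_upwards [compl_mem_ae_iff.mpr (measure_singleton (0 : V))] with ξ hξ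
  have hξ : 0 < ‖ξ‖ := norm_pos_iff.mpr hξ
  refine tendsto_const_nhds.congr' ?_
  have h : Tendsto (fun n : ℕ => (2 : ℝ) ^ n) atTop atTop :=
    tendsto_pow_atTop_atTop_of_one_lt one_lt_two
  filter_upwards [h.eventually_ge_atTop (2 / (2 ^ (-j) * ‖ξ‖))] with n hn
  rw [dil_apply, LPF.low_apply, χ.supp]
  · simp
  rw [div_le_iff₀ (by positivity)] at hn
  rw [norm_smul, norm_zpow, Real.norm_ofNat, neg_sub, sub_eq_add_neg, zpow_add₀ two_ne_zero,
    zpow_natCast, mul_assoc]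
  exact hn

theorem LPF.norm_cut_le (χ : LPF V) (k : ℤ) (f : 𝓢(V, ℂ)) (x : V) :
    ‖χ.cut k f x‖ ≤ ∫ ξ, ‖𝓕 f ξ‖ := by
  rw [LPF.cut, mult_coe, Real.fourierInv_eq']
  refine norm_integral_le_of_norm_le (𝓕 f).integrable.norm (Eventually.of_forall fun ξ => ?_)
  rw [norm_smul, Complex.norm_exp_ofReal_mul_I, one_mul, norm_mul]
  exact mul_le_of_le_one_left (norm_nonneg _) (χ.norm_dil_low_le k ξ)

theorem tendsto_mult_of_bounded (m : 𝓢(V, ℂ)) {h : ℕ → 𝓢(V, ℂ)} {f : 𝓢(V, ℂ)} {C : ℝ}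
    (hb : ∀ n x, ‖h n x‖ ≤ C) (ht : ∀ x, Tendsto (fun n => h n x) atTop (𝓝 (f x))) (x : V) :
    Tendsto (fun n => mult m (h n) x) atTop (𝓝 (mult m f x)) := by
  simp only [mult_apply]
  refine tendsto_integral_of_dominated_convergence (fun z => ‖𝓕⁻ m z‖ * C) (fun n => ?_)
    ((𝓕⁻ m).integrable.norm.mul_const C) (fun n => Eventually.of_forall fun z => ?_)
    (Eventually.of_forall fun z => (ht _).const_mul _)
  · exact ((𝓕⁻ m).continuous.mul
      ((h n).continuous.comp (continuous_const.sub continuous_id))).aestronglyMeasurable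
  · rw [norm_mul]
    gcongr
    exact hb n _

theorem int_Ico_add_one {a b : ℤ} (h : a ≤ b) :
    Finset.Ico a (b + 1) = insert b (Finset.Ico a b) := by
  ext; simp; omega

theorem LPF.cut_eq_add_sum (χ : LPF V) (f : 𝓢(V, ℂ)) (x : V) {a b : ℤ} (h : a ≤ b) :
    χ.cut b f x = χ.cut a f x + ∑ k ∈ Finset.Ico a b, χ.lp k f x := by
  induction b, h using Int.leInduction with
  | base => simp
  | succ b h ih =>
    rw [int_Ico_add_one h, Finset.sum_insert (by simp), LPF.cut_add_one, add_apply, ih]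
    ring

theorem LPF.cut_mul_cut (χ : LPF V) (f g : 𝓢(V, ℂ)) (x : V) {a b : ℤ} (h : a ≤ b) :
    χ.cut b f x * χ.cut b g x = χ.cut a f x * χ.cut a g x +
      ∑ k ∈ Finset.Ico a b, (χ.cut (k + 1) f x * χ.lp k g x + χ.cut k g x * χ.lp k f x) := by
  induction b, h using Int.leInduction with
  | base => simp
  | succ b h ih =>
    rw [int_Ico_add_one h, Finset.sum_insert (by simp), LPF.cut_add_one, LPF.cut_add_one,
      add_apply, add_apply]
    linear_combination ih

end Products

end MHD

namespace MHD

open FourierTransform SchwartzMap Filter Topology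

set_option linter.unusedSectionVars false

section Algebra

variable {V : Type*} [NormedAddCommGroup V] [InnerProductSpace ℝ V]
    [FiniteDimensional ℝ V] [MeasurableSpace V] [BorelSpace V]

theorem LPF.exists_enorm_lp_le (χ : LPF V) {p : ℝ} (hp : 1 < p) :
    ∃ C : ℝ≥0∞, C ≠ ∞ ∧ ∀ (k : ℤ) (f : 𝓢(V, ℂ)) (x : V), ‖χ.lp k f x‖ₑ ≤
      C * (2 ^ (Module.finrank ℝ V / p * k : ℝ) *
        eLpNorm (χ.lp k f) (ENNReal.ofReal p) volume) := by
  have hpq := Real.HolderConjugate.conjExponent hp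
  refine ⟨2 ^ (Module.finrank ℝ V / p * 2 : ℝ) *
    (∫⁻ z, ‖(𝓕⁻ χ.low) z‖ₑ ^ p.conjExponent) ^ (1 / p.conjExponent),
    ENNReal.mul_ne_top (two_rpow_ne_top _)
      (lintegral_enorm_rpow_lt_top hpq.symm.pos _).ne, fun k f x => ?_⟩
  have h := enorm_mult_le_eLpNorm hpq (dil (k + 2) χ.low) (χ.lp k f) x
  rw [lintegral_enorm_rpow_fourierInv_dil hpq] at h
  have h2 : mult (dil (k + 2) χ.low) (χ.lp k f) = χ.lp k f := χ.cut_lp k f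
  rw [h2] at h
  refine h.trans_eq ?_
  push_cast
  rw [mul_add, ← two_rpow_mul_two_rpow]
  ring

theorem LPF.exists_enorm_cut_le [Nontrivial V] (χ : LPF V) {p : ℝ} (hp : 1 < p) :
    ∃ C : ℝ≥0∞, C ≠ ∞ ∧ ∀ (k : ℤ) (f : 𝓢(V, ℂ)) (x : V), ‖χ.cut k f x‖ₑ ≤
      C * besov χ (Module.finrank ℝ V / p) p f := by
  obtain ⟨C, hC, h⟩ := χ.exists_enorm_lp_le hp
  refine ⟨C, hC, fun k f x => ?_⟩
  have key : ∀ n : ℕ, ‖χ.cut k f x‖ₑ ≤ ‖χ.cut (k - n) f x‖ₑ +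
      C * besov χ (Module.finrank ℝ V / p) p f := fun n => by
    rw [χ.cut_eq_add_sum f x (a := k - n) (b := k) (by omega)]
    refine (enorm_add_le _ _).trans ?_
    gcongr
    refine (enorm_sum_le _ _).trans ?_
    rw [besov_coe, ← ENNReal.tsum_mul_left]
    exact (Finset.sum_le_sum fun i _ => h i f x).trans (ENNReal.sum_le_tsum _)
  have hl : Tendsto (fun n : ℕ => ‖χ.cut (k - n) f x‖ₑ +
      C * besov χ (Module.finrank ℝ V / p) p f) atTop
      (𝓝 (‖(0 : ℂ)‖ₑ + C * besov χ (Module.finrank ℝ V / p) p f)) :=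
    ((continuous_enorm.tendsto _).comp (χ.tendsto_cut_neg f k x)).add_const _
  rw [enorm_zero, zero_add] at hl
  exact ge_of_tendsto' hl key

theorem mult_sum (m : 𝓢(V, ℂ)) {ι : Type*} (s : Finset ι) (f : ι → 𝓢(V, ℂ)) :
    mult m (∑ i ∈ s, f i) = ∑ i ∈ s, mult m (f i) :=
  map_sum (fourierMultiplierCLM ℂ (m : V → ℂ)) f s

theorem mult_add (m f g : 𝓢(V, ℂ)) : mult m (f + g) = mult m f + mult m g :=
  map_add (fourierMultiplierCLM ℂ (m : V → ℂ)) f g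

theorem sum_coe {ι : Type*} (s : Finset ι) (f : ι → 𝓢(V, ℂ)) :
    ((∑ i ∈ s, f i : 𝓢(V, ℂ)) : V → ℂ) = ∑ i ∈ s, (f i : V → ℂ) := by
  ext x
  rw [Finset.sum_apply]
  classical
  induction s using Finset.induction with
  | empty => simp
  | insert a s ha ih => rw [Finset.sum_insert ha, Finset.sum_insert ha, add_apply, ih]

theorem eLpNorm_sum_coe_le {p : ℝ} (hp : 1 ≤ p) {ι : Type*} (s : Finset ι) (f : ι → 𝓢(V, ℂ)) :
    eLpNorm (∑ i ∈ s, f i : 𝓢(V, ℂ)) (ENNReal.ofReal p) volume ≤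
      ∑ i ∈ s, eLpNorm (f i) (ENNReal.ofReal p) volume := by
  rw [sum_coe]
  exact eLpNorm_sum_le (fun i _ => (f i).continuous.aestronglyMeasurable)
    (by simpa using hp)

/-- The piece of the product `f g` carried by the frequencies of order `2^k`. -/
def LPF.para (χ : LPF V) (f g : 𝓢(V, ℂ)) (k : ℤ) : 𝓢(V, ℂ) :=
  prd (χ.cut (k + 1) f) (χ.lp k g) + prd (χ.cut k g) (χ.lp k f)

theorem LPF.sum_para_apply (χ : LPF V) (f g : 𝓢(V, ℂ)) (n : ℕ) (x : V) :
    (∑ k ∈ Finset.Ico (-(n : ℤ)) n, χ.para f g k) x =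
      χ.cut n f x * χ.cut n g x - χ.cut (-n) f x * χ.cut (-n) g x := by
  rw [χ.cut_mul_cut f g x (a := -(n : ℤ)) (b := n) (by omega), sum_coe, Finset.sum_apply]
  simp [LPF.para, prd_apply]

theorem LPF.eLpNorm_lp_prd_le [Nontrivial V] (χ : LPF V) {p : ℝ} (hp : 1 ≤ p) (q : ℤ)
    (f g : 𝓢(V, ℂ)) :
    eLpNorm (χ.lp q (prd f g)) (ENNReal.ofReal p) volume ≤
      ∑' k : ℤ, eLpNorm (χ.lp q (χ.para f g k)) (ENNReal.ofReal p) volume := by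
  have ht : ∀ x, Tendsto (fun n : ℕ => (∑ k ∈ Finset.Ico (-(n : ℤ)) n, χ.para f g k) x) atTop
      (𝓝 (prd f g x)) := fun x => by
    simp only [χ.sum_para_apply, prd_apply]
    have h1 := (χ.tendsto_cut f x).mul (χ.tendsto_cut g x)
    have h2 := (χ.tendsto_cut_neg f 0 x).mul (χ.tendsto_cut_neg g 0 x)
    simpa using h1.sub h2
  have hb : ∀ (n : ℕ) x, ‖(∑ k ∈ Finset.Ico (-(n : ℤ)) n, χ.para f g k) x‖ ≤
      (∫ ξ, ‖𝓕 f ξ‖) * (∫ ξ, ‖𝓕 g ξ‖) + (∫ ξ, ‖𝓕 f ξ‖) * (∫ ξ, ‖𝓕 g ξ‖) := fun n x => by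
    rw [χ.sum_para_apply]
    refine (norm_sub_le _ _).trans ?_
    rw [norm_mul, norm_mul]
    gcongr <;> exact χ.norm_cut_le _ _ _
  have hlim := tendsto_mult_of_bounded (dil q χ.band) hb ht
  refine (Lp.eLpNorm_lim_le_liminf_eLpNorm
    (fun n => (SchwartzMap.continuous _).aestronglyMeasurable) _
    (Eventually.of_forall hlim)).trans ?_
  refine liminf_le_of_le (by isBoundedDefault) fun b hb => ?_
  obtain ⟨n, hn⟩ := hb.exists
  refine hn.trans ?_
  rw [mult_sum]
  exact (eLpNorm_sum_coe_le hp _ _).trans (ENNReal.sum_le_tsum _)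

theorem LPF.eLpNorm_lp_le (χ : LPF V) {p : ℝ} (hp : 1 < p) (q : ℤ) (f : 𝓢(V, ℂ)) :
    eLpNorm (χ.lp q f) (ENNReal.ofReal p) volume ≤
      (∫⁻ z, ‖(𝓕⁻ χ.band) z‖ₑ) * eLpNorm f (ENNReal.ofReal p) volume := by
  rw [← lintegral_enorm_fourierInv_dil q]
  exact eLpNorm_mult_le hp _ f

theorem LPF.exists_eLpNorm_lp_para_le [Nontrivial V] (χ : LPF V) {p : ℝ} (hp : 1 < p) :
    ∃ C : ℝ≥0∞, C ≠ ∞ ∧ ∀ (q k : ℤ) (f g : 𝓢(V, ℂ)),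
      eLpNorm (χ.lp q (χ.para f g k)) (ENNReal.ofReal p) volume ≤
        if q ≤ k + 2 then
          C * (besov χ (Module.finrank ℝ V / p) p f *
              eLpNorm (χ.lp k g) (ENNReal.ofReal p) volume +
            besov χ (Module.finrank ℝ V / p) p g *
              eLpNorm (χ.lp k f) (ENNReal.ofReal p) volume)
        else 0 := by
  obtain ⟨C, hC, h⟩ := χ.exists_enorm_cut_le hp
  have hp0 : 0 < p := by linarith
  refine ⟨(∫⁻ z, ‖(𝓕⁻ χ.band) z‖ₑ) * C,
    ENNReal.mul_ne_top (lintegral_enorm_lt_top _).ne hC, fun q k f g => ?_⟩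
  have hpara : χ.lp q (χ.para f g k) = χ.lp q (prd (χ.cut (k + 1) f) (χ.lp k g)) +
      χ.lp q (prd (χ.cut k g) (χ.lp k f)) := mult_add _ _ _
  split_ifs with hq
  · have hadd : eLpNorm (χ.para f g k) (ENNReal.ofReal p) volume ≤
        eLpNorm (prd (χ.cut (k + 1) f) (χ.lp k g)) (ENNReal.ofReal p) volume +
        eLpNorm (prd (χ.cut k g) (χ.lp k f)) (ENNReal.ofReal p) volume :=
      eLpNorm_add_le (SchwartzMap.continuous _).aestronglyMeasurable
        (SchwartzMap.continuous _).aestronglyMeasurable (by simpa using hp.le)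
    refine (χ.eLpNorm_lp_le hp q _).trans ?_
    rw [mul_assoc]
    gcongr
    refine hadd.trans ?_
    rw [mul_add, ← mul_assoc, ← mul_assoc]
    gcongr
    · exact eLpNorm_prd_le _ _ (h _ f) hp0
    · exact eLpNorm_prd_le _ _ (h _ g) hp0
  · rw [hpara, χ.lp_prd_cut_lp (by omega), χ.lp_prd_cut_lp' (by omega), add_zero]
    exact (eLpNorm_zero (p := ENNReal.ofReal p) (μ := (volume : Measure V)) (ε := ℂ)).le

theorem tsum_two_rpow_ne_top {σ : ℝ} (hσ : 0 < σ) :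
    (∑' q : ℤ, if q ≤ 2 then (2 : ℝ≥0∞) ^ (σ * q) else 0) ≠ ∞ := by
  have hinj : Function.Injective fun n : ℕ => (2 : ℤ) - n := fun a b h => by
    simp only at h; omega
  rw [← hinj.tsum_eq (f := fun q : ℤ => if q ≤ 2 then (2 : ℝ≥0∞) ^ (σ * q) else 0)]
  · have : ∀ n : ℕ, (if (2 : ℤ) - n ≤ 2 then (2 : ℝ≥0∞) ^ (σ * ((2 - n : ℤ) : ℝ)) else 0) =
        2 ^ (σ * 2) * (2 ^ (-σ)) ^ n := fun n => by
      rw [if_pos (by omega), ← ENNReal.rpow_natCast, ← ENNReal.rpow_mul, two_rpow_mul_two_rpow]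
      congr 1; push_cast; ring
    simp only [this]
    rw [ENNReal.tsum_mul_left, ENNReal.tsum_geometric]
    refine ENNReal.mul_ne_top (two_rpow_ne_top _) (ENNReal.inv_ne_top.mpr ?_)
    rw [← pos_iff_ne_zero, tsub_pos_iff_lt]
    exact ENNReal.rpow_lt_one_of_one_lt_of_neg (by norm_num) (by linarith)
  · intro q hq
    simp only [Function.mem_support, ne_eq, ite_eq_right_iff, not_forall] at hq
    obtain ⟨hq, -⟩ := hq
    exact ⟨(2 - q).toNat, by simp only; omega⟩

/-- The Besov space of regularity `d / p` is an algebra. -/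
theorem LPF.exists_besov_prd_le [Nontrivial V] (χ : LPF V) {p : ℝ} (hp : 1 < p) :
    ∃ C : ℝ≥0∞, C ≠ ∞ ∧ ∀ f g : 𝓢(V, ℂ), besov χ (Module.finrank ℝ V / p) p (prd f g) ≤
      C * (besov χ (Module.finrank ℝ V / p) p f * besov χ (Module.finrank ℝ V / p) p g) := by
  obtain ⟨C, hC, h⟩ := χ.exists_eLpNorm_lp_para_le hp
  set σ : ℝ := Module.finrank ℝ V / p with hσ
  have hσ0 : 0 < σ := div_pos (by exact_mod_cast Module.finrank_pos) (by linarith)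
  set G := ∑' q : ℤ, if q ≤ 2 then (2 : ℝ≥0∞) ^ (σ * q) else 0 with hG
  refine ⟨G * C * 2, ENNReal.mul_ne_top (ENNReal.mul_ne_top (tsum_two_rpow_ne_top hσ0) hC)
    (by simp), fun f g => ?_⟩
  set c : ℤ → ℝ≥0∞ := fun k => C * (besov χ σ p f * eLpNorm (χ.lp k g) (ENNReal.ofReal p) volume +
    besov χ σ p g * eLpNorm (χ.lp k f) (ENNReal.ofReal p) volume) with hc
  have hshift : ∀ k : ℤ, (∑' q : ℤ, if q ≤ k + 2 then (2 : ℝ≥0∞) ^ (σ * q) else 0) =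
      2 ^ (σ * k) * G := fun k => by
    rw [← (Equiv.addRight k).tsum_eq, hG, ← ENNReal.tsum_mul_left]
    refine tsum_congr fun q => ?_
    have e : (Equiv.addRight k) q = q + k := rfl
    by_cases hq : q ≤ 2
    · rw [if_pos (by rw [e]; omega), if_pos hq, two_rpow_mul_two_rpow, e]
      congr 1; push_cast; ring
    · rw [if_neg (by rw [e]; omega), if_neg hq, mul_zero]
  calc besov χ σ p (prd f g)
      = ∑' q : ℤ, 2 ^ (σ * q) * eLpNorm (χ.lp q (prd f g)) (ENNReal.ofReal p) volume :=
        besov_coe _ _ _ _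
    _ ≤ ∑' q : ℤ, 2 ^ (σ * q) * ∑' k : ℤ, if q ≤ k + 2 then c k else 0 := by
        gcongr with q
        refine (χ.eLpNorm_lp_prd_le hp.le q f g).trans ?_
        gcongr with k
        exact h q k f g
    _ = ∑' k : ℤ, c k * ∑' q : ℤ, if q ≤ k + 2 then (2 : ℝ≥0∞) ^ (σ * q) else 0 := by
        simp only [← ENNReal.tsum_mul_left]
        rw [ENNReal.tsum_comm]
        refine tsum_congr fun k => tsum_congr fun q => ?_
        split_ifs <;> ring
    _ = G * C * 2 * (besov χ σ p f * besov χ σ p g) := by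
        simp only [hshift, hc]
        have e : ∀ k : ℤ, C * (besov χ σ p f * eLpNorm (χ.lp k g) (ENNReal.ofReal p) volume +
            besov χ σ p g * eLpNorm (χ.lp k f) (ENNReal.ofReal p) volume) * (2 ^ (σ * k) * G) =
            G * C * besov χ σ p f * (2 ^ (σ * k) *
              eLpNorm (χ.lp k g) (ENNReal.ofReal p) volume) +
            G * C * besov χ σ p g * (2 ^ (σ * k) *
              eLpNorm (χ.lp k f) (ENNReal.ofReal p) volume) := fun k => by ring
        simp only [e]
        rw [ENNReal.tsum_add, ENNReal.tsum_mul_left, ENNReal.tsum_mul_left, ← besov_coe,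
          ← besov_coe]
        ring

end Algebra

end MHD

namespace MHD

open FourierTransform SchwartzMap LineDeriv

set_option linter.unusedSectionVars false

section Derivatives

variable {V : Type*} [NormedAddCommGroup V] [InnerProductSpace ℝ V]
    [FiniteDimensional ℝ V] [MeasurableSpace V] [BorelSpace V]

theorem fourier_lineDeriv_apply (v : V) (f : 𝓢(V, ℂ)) (ξ : V) :
    𝓕 (∂_{v} f : 𝓢(V, ℂ)) ξ = 2 * Real.pi * Complex.I * (inner ℝ ξ v : ℝ) * 𝓕 f ξ := by
  have : (inner ℝ · v : V → ℝ).HasTemperateGrowth := by fun_prop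
  rw [SchwartzMap.fourier_lineDerivOp_eq, smul_apply, smulLeftCLM_apply_apply this]
  simp [mul_assoc]

/-- The symbol of `∂_v`, truncated to frequencies at most `4`. -/
def LPF.derivSymbol (χ : LPF V) (v : V) : 𝓢(V, ℂ) :=
  HasCompactSupport.toSchwartzMap
    (f := fun ξ => 2 * Real.pi * Complex.I * (inner ℝ ξ v : ℝ) * dil 2 χ.low ξ)
    (hasCompactSupport_of_forall_le (R := 8) fun ξ h => by
      rw [dil_apply, LPF.low_apply, χ.supp]
      · simp
      · rw [norm_smul]; norm_num; linarith)
    (((contDiff_const).mul (Complex.ofRealCLM.contDiff.comp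
      (contDiff_id.inner ℝ contDiff_const))).mul ((dil 2 χ.low).smooth _))

theorem LPF.derivSymbol_apply (χ : LPF V) (v ξ : V) : χ.derivSymbol v ξ =
    2 * Real.pi * Complex.I * (inner ℝ ξ v : ℝ) * dil 2 χ.low ξ := rfl

theorem LPF.wide_mul_band (χ : LPF V) (ξ : V) : dil 2 χ.low ξ * χ.band ξ = χ.band ξ := by
  rw [dil_apply, LPF.band_apply, LPF.low_apply]
  by_cases h : 4 ≤ ‖ξ‖
  · rw [χ.phiHat_eq_zero_of_four_le h]; simp
  · rw [χ.eq_one, Complex.ofReal_one, one_mul]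
    rw [norm_smul]; norm_num; linarith

theorem LPF.narrow_mul_band (χ : LPF V) (ξ : V) : dil (-1) χ.low ξ * χ.band ξ = 0 := by
  rw [dil_apply, LPF.band_apply, LPF.low_apply]
  by_cases h : ‖ξ‖ ≤ 1
  · rw [χ.phiHat_eq_zero_of_le_one h]; simp
  · rw [χ.supp, Complex.ofReal_zero, zero_mul]
    rw [norm_smul]; norm_num; linarith

/-- The symbol inverting the gradient on frequencies between `1` and `4`. -/
def LPF.gradInvSymbol (χ : LPF V) (v : V) : 𝓢(V, ℂ) :=
  HasCompactSupport.toSchwartzMap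
    (f := fun ξ => (2 * Real.pi * Complex.I)⁻¹ * ((inner ℝ ξ v / ‖ξ‖ ^ 2 : ℝ) : ℂ) *
      (dil 2 χ.low ξ - dil (-1) χ.low ξ))
    (hasCompactSupport_of_forall_le (R := 8) fun ξ h => by
      rw [dil_apply, LPF.low_apply, χ.supp, dil_apply, LPF.low_apply, χ.supp]
      · simp
      · rw [norm_smul]; norm_num; linarith
      · rw [norm_smul]; norm_num; linarith)
    (contDiff_iff_contDiffAt.mpr fun ξ => by
      by_cases h : ξ = 0
      · subst h
        refine (contDiffAt_const (c := (0 : ℂ))).congr_of_eventuallyEq ?_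
        filter_upwards [Metric.ball_mem_nhds (0 : V) (ε := 1 / 2) (by norm_num)] with ξ h
        rw [mem_ball_zero_iff] at h
        rw [dil_apply, LPF.low_apply, χ.eq_one, dil_apply, LPF.low_apply, χ.eq_one]
        · simp
        · rw [norm_smul]; norm_num; linarith
        · rw [norm_smul]; norm_num; linarith
      · refine (contDiffAt_const.mul (Complex.ofRealCLM.contDiff.contDiffAt.comp ξ
          (ContDiffAt.div (contDiffAt_id.inner ℝ contDiffAt_const)
            (contDiffAt_id.norm_sq ℝ) ?_))).mul
          (((dil 2 χ.low).smooth _).contDiffAt.sub ((dil (-1) χ.low).smooth _).contDiffAt)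
        simpa using h)

theorem LPF.gradInvSymbol_apply (χ : LPF V) (v ξ : V) : χ.gradInvSymbol v ξ =
    (2 * Real.pi * Complex.I)⁻¹ * ((inner ℝ ξ v / ‖ξ‖ ^ 2 : ℝ) : ℂ) *
      (dil 2 χ.low ξ - dil (-1) χ.low ξ) := rfl

theorem LPF.lp_lineDeriv (χ : LPF V) (k : ℤ) (v : V) (f : 𝓢(V, ℂ)) :
    χ.lp k (∂_{v} f) = (2 : ℂ) ^ k • mult (dil k (χ.derivSymbol v)) (χ.lp k f) := by
  refine fourier_injective fun ξ => ?_
  rw [FourierTransform.fourier_smul, smul_apply, LPF.lp, LPF.lp, fourier_mult, fourier_mult,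
    fourier_mult, fourier_lineDeriv_apply, dil_apply, dil_apply, LPF.derivSymbol_apply]
  have h := χ.wide_mul_band ((2 : ℝ) ^ (-k) • ξ)
  have h2 : (2 : ℂ) ^ k ≠ 0 := zpow_ne_zero _ two_ne_zero
  have h3 : ((inner ℝ ((2 : ℝ) ^ (-k) • ξ) v : ℝ) : ℂ) = ((2 : ℂ) ^ k)⁻¹ * (inner ℝ ξ v : ℝ) := by
    rw [inner_smul_left]; simp
  rw [h3, smul_eq_mul]
  field_simp
  linear_combination -(inner ℝ ξ v : ℝ) * (𝓕 f ξ) * h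

theorem enorm_two_zpow (k : ℤ) : ‖(2 : ℂ) ^ k‖ₑ = (2 : ℝ≥0∞) ^ (k : ℝ) := by
  rw [← ofReal_norm, norm_zpow, RCLike.norm_ofNat, ← ofReal_two_rpow, Real.rpow_intCast]

theorem smul_coe (c : ℂ) (f : 𝓢(V, ℂ)) : ((c • f : 𝓢(V, ℂ)) : V → ℂ) = c • (f : V → ℂ) := rfl

theorem eLpNorm_mult_dil_le {p : ℝ} (hp : 1 < p) (k : ℤ) (m f : 𝓢(V, ℂ)) :
    eLpNorm (mult (dil k m) f) (ENNReal.ofReal p) volume ≤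
      (∫⁻ z, ‖(𝓕⁻ m) z‖ₑ) * eLpNorm f (ENNReal.ofReal p) volume := by
  rw [← lintegral_enorm_fourierInv_dil k m]
  exact eLpNorm_mult_le hp _ _

theorem besov_lineDeriv_le (χ : LPF V) {p : ℝ} (hp : 1 < p) (s : ℝ) (v : V) (f : 𝓢(V, ℂ)) :
    besov χ (-1 + s) p (∂_{v} f : 𝓢(V, ℂ)) ≤
      (∫⁻ z, ‖(𝓕⁻ (χ.derivSymbol v)) z‖ₑ) * besov χ s p f := by
  rw [besov_coe, besov_coe, ← ENNReal.tsum_mul_left]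
  refine ENNReal.tsum_le_tsum fun k => ?_
  rw [χ.lp_lineDeriv, smul_coe, eLpNorm_const_smul, enorm_two_zpow, ← mul_assoc,
    two_rpow_mul_two_rpow, mul_left_comm, show (-1 + s) * (k : ℝ) + k = s * k by ring]
  gcongr
  exact eLpNorm_mult_dil_le hp _ _ _

theorem LPF.lp_eq_sum_lineDeriv {n : ℕ} (χ : LPF (Euc n)) (k : ℤ) (f : 𝓢(Euc n, ℂ)) :
    χ.lp k f = (2 : ℂ) ^ (-k) • ∑ i : Fin n,
      mult (dil k (χ.gradInvSymbol (EuclideanSpace.single i 1)))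
        (χ.lp k (∂_{(EuclideanSpace.single i 1 : Euc n)} f)) := by
  refine fourier_injective fun ξ => ?_
  have hs : ∀ g : Fin n → 𝓢(Euc n, ℂ), 𝓕 (∑ i, g i) ξ = ∑ i, 𝓕 (g i) ξ := fun g => by
    rw [FourierTransform.fourier_sum, sum_coe, Finset.sum_apply]
  rw [FourierTransform.fourier_smul, smul_apply, hs, LPF.lp, fourier_mult]
  simp only [LPF.lp, fourier_mult, fourier_lineDeriv_apply]
  simp only [dil_apply k, LPF.gradInvSymbol_apply]
  set η := (2 : ℝ) ^ (-k) • ξ with hη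
  have h2 : (2 : ℂ) ^ k ≠ 0 := zpow_ne_zero _ two_ne_zero
  have h3 : ∀ v : Euc n, ((inner ℝ ξ v : ℝ) : ℂ) = (2 : ℂ) ^ k * (inner ℝ η v : ℝ) := fun v => by
    rw [hη, inner_smul_left]; simp [h2]
  have hw := χ.wide_mul_band η
  have hn := χ.narrow_mul_band η
  by_cases h0 : χ.band η = 0
  · simp [h0]
  have hη0 : η ≠ 0 := fun h => h0 (by
    rw [LPF.band_apply, h, χ.phiHat_eq_zero_of_le_one (by simp), Complex.ofReal_zero])
  have hsq : ∑ i : Fin n, ((inner ℝ η (EuclideanSpace.single i 1) : ℝ) : ℂ) ^ 2 =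
      ((‖η‖ ^ 2 : ℝ) : ℂ) := by
    rw [EuclideanSpace.norm_sq_eq]
    push_cast
    refine Finset.sum_congr rfl fun i _ => ?_
    rw [EuclideanSpace.inner_single_right]
    simp [← Complex.ofReal_pow]
  have hpi : (Real.pi : ℂ) ≠ 0 := by simp [Real.pi_ne_zero]
  have hN : ((‖η‖ ^ 2 : ℝ) : ℂ) ≠ 0 := by simpa using hη0
  have e : ∀ i : Fin n, (2 * Real.pi * Complex.I)⁻¹ *
      ((inner ℝ η (EuclideanSpace.single i 1) / ‖η‖ ^ 2 : ℝ) : ℂ) *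
      (dil 2 χ.low η - dil (-1) χ.low η) * (χ.band η * (2 * Real.pi * Complex.I *
        (inner ℝ ξ (EuclideanSpace.single i 1) : ℝ) * 𝓕 f ξ)) =
      ((inner ℝ η (EuclideanSpace.single i 1) : ℝ) : ℂ) ^ 2 *
        ((2 : ℂ) ^ k * (((‖η‖ ^ 2 : ℝ) : ℂ))⁻¹ * (χ.band η * 𝓕 f ξ)) := fun i => by
    have hb : (dil 2 χ.low η - dil (-1) χ.low η) * χ.band η = χ.band η := by
      rw [sub_mul, hw, hn, sub_zero]
    rw [mul_assoc _ (dil 2 χ.low η - dil (-1) χ.low η), ← mul_assoc _ (χ.band η), hb, h3,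
      Complex.ofReal_div]
    field_simp
  simp only [e]
  rw [← Finset.sum_mul, hsq, smul_eq_mul, zpow_neg]
  field_simp

theorem besov_le_sum_lineDeriv {n : ℕ} (χ : LPF (Euc n)) {p : ℝ} (hp : 1 < p) (s : ℝ)
    (f : 𝓢(Euc n, ℂ)) :
    besov χ s p f ≤ ∑ i : Fin n,
      (∫⁻ z, ‖(𝓕⁻ (χ.gradInvSymbol (EuclideanSpace.single i 1))) z‖ₑ) *
        besov χ (-1 + s) p (∂_{(EuclideanSpace.single i 1 : Euc n)} f : 𝓢(Euc n, ℂ)) := by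
  simp only [besov_coe, ← ENNReal.tsum_mul_left]
  rw [← Summable.tsum_finsetSum fun _ _ => ENNReal.summable]
  gcongr with k
  rw [χ.lp_eq_sum_lineDeriv, smul_coe, eLpNorm_const_smul, enorm_two_zpow, ← mul_assoc,
    two_rpow_mul_two_rpow, show s * (k : ℝ) + (-k : ℤ) = (-1 + s) * k by push_cast; ring]
  refine (mul_le_mul_right (eLpNorm_sum_coe_le hp.le _ _) _).trans ?_
  rw [Finset.mul_sum]
  refine Finset.sum_le_sum fun i _ => ?_
  rw [mul_left_comm]
  gcongr
  exact eLpNorm_mult_dil_le hp _ _ _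

end Derivatives

end MHD

namespace MHD

open FourierTransform SchwartzMap LineDeriv

set_option linter.unusedSectionVars false

/-- Smooth compactly supported real functions. -/
structure IsTest {E : Type*} [NormedAddCommGroup E] [NormedSpace ℝ E] (f : E → ℝ) : Prop where
  smooth : ContDiff ℝ (⊤ : ℕ∞) f
  cpt : HasCompactSupport f

section Time

variable {V : Type*} [NormedAddCommGroup V] [InnerProductSpace ℝ V]
    [FiniteDimensional ℝ V] [MeasurableSpace V] [BorelSpace V]

/-- The complex Schwartz function attached to a real test function. -/
def IsTest.toS {f : V → ℝ} (h : IsTest f) : 𝓢(V, ℂ) :=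
  HasCompactSupport.toSchwartzMap (f := fun y => (f y : ℂ))
    (h.cpt.comp_left Complex.ofReal_zero) (Complex.ofRealCLM.contDiff.comp h.smooth)

theorem IsTest.toS_apply {f : V → ℝ} (h : IsTest f) (y : V) : h.toS y = f y := rfl

theorem IsTest.toS_coe {f : V → ℝ} (h : IsTest f) : (h.toS : V → ℂ) = fun y => (f y : ℂ) := rfl

theorem IsTest.slice {w : ℝ → V → ℝ} (h : IsTest (Function.uncurry w)) (t : ℝ) : IsTest (w t) where
  smooth := h.smooth.comp (contDiff_prodMk_right t)
  cpt := HasCompactSupport.intro (h.cpt.isCompact.image continuous_snd) fun y hy => by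
    refine image_eq_zero_of_notMem_tsupport (f := Function.uncurry w) (x := (t, y)) fun hm => ?_
    exact hy ⟨_, hm, rfl⟩

theorem IsTest.fderiv_slice {w : ℝ → V → ℝ} (h : IsTest (Function.uncurry w)) (t : ℝ) (y v : V) :
    fderiv ℝ (w t) y v = fderiv ℝ (Function.uncurry w) (t, y) (0, v) := by
  have h1 : HasFDerivAt (Function.uncurry w) (fderiv ℝ (Function.uncurry w) (t, y)) (t, y) :=
    (h.smooth.differentiable (by simp) _).hasFDerivAt
  have h2 := h1.comp y (hasFDerivAt_prodMk_right t y)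
  have h3 : Function.uncurry w ∘ Prod.mk t = w t := rfl
  rw [h3] at h2
  rw [h2.fderiv]
  simp

theorem IsTest.fderiv_apply {E : Type*} [NormedAddCommGroup E] [NormedSpace ℝ E] {f : E → ℝ}
    (h : IsTest f) (v : E) : IsTest fun x => fderiv ℝ f x v where
  smooth := (h.smooth.fderiv_right (m := (⊤ : ℕ∞)) (by simp)).clm_apply contDiff_const
  cpt := (h.cpt.fderiv ℝ).comp_left (g := fun L : E →L[ℝ] ℝ => L v) rfl

theorem IsTest.fderiv_uncurry {w : ℝ → V → ℝ} (h : IsTest (Function.uncurry w)) (v : V) :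
    IsTest (Function.uncurry fun t y => fderiv ℝ (w t) y v) := by
  have : (Function.uncurry fun t y => fderiv ℝ (w t) y v) =
      fun z => fderiv ℝ (Function.uncurry w) z (0, v) := by
    ext ⟨t, y⟩
    exact h.fderiv_slice t y v
  rw [this]
  exact h.fderiv_apply _

theorem IsTest.exists_bound {E : Type*} [NormedAddCommGroup E] [NormedSpace ℝ E] {f : E → ℝ}
    (h : IsTest f) : ∃ M, ∀ x, ‖f x‖ ≤ M :=
  h.cpt.exists_bound_of_continuous h.smooth.continuous

theorem IsTest.integral {w : ℝ → V → ℝ} (h : IsTest (Function.uncurry w)) (μ : Measure ℝ)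
    [IsLocallyFiniteMeasure μ] : IsTest fun y => ∫ τ, w τ y ∂μ where
  smooth := by
    have hk : IsCompact ((fun z : ℝ × V => -z.1) '' tsupport (Function.uncurry w)) :=
      h.cpt.isCompact.image (by fun_prop)
    have hc := contDiffOn_convolution_right_with_param_comp (n := ⊤) (μ := μ)
      (ContinuousLinearMap.lsmul ℝ ℝ) (s := Set.univ) (v := fun _ : V => (0 : ℝ))
      (f := fun _ => (1 : ℝ)) (g := fun y x => w (-x) y) contDiffOn_const isOpen_univ hk
      (fun y x _ hx => by
        refine image_eq_zero_of_notMem_tsupport (f := Function.uncurry w) (x := (-x, y))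
          fun hm => hx ⟨_, hm, by simp⟩) (locallyIntegrable_const _)
      (h.smooth.comp (contDiff_snd.neg.prodMk contDiff_fst)).contDiffOn
    rw [contDiffOn_univ] at hc
    simpa [MeasureTheory.convolution] using hc
  cpt := HasCompactSupport.intro (h.cpt.isCompact.image continuous_snd) fun y hy => by
    refine integral_eq_zero_of_ae (Filter.Eventually.of_forall fun τ => ?_)
    refine image_eq_zero_of_notMem_tsupport (f := Function.uncurry w) (x := (τ, y)) fun hm => ?_
    exact hy ⟨_, hm, rfl⟩

theorem stronglyMeasurable_mult {w : ℝ → V → ℝ} (h : IsTest (Function.uncurry w))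
    (m : 𝓢(V, ℂ)) :
    StronglyMeasurable fun z : ℝ × V => mult m (h.slice z.1).toS z.2 := by
  simp only [mult_apply, IsTest.toS_apply]
  have hw : Continuous fun q : ℝ × V => (w q.1 q.2 : ℂ) :=
    Complex.continuous_ofReal.comp h.smooth.continuous
  have : Continuous fun q : (ℝ × V) × V => (𝓕⁻ m) q.2 * (w q.1.1 (q.1.2 - q.2) : ℂ) :=
    ((𝓕⁻ m).continuous.comp continuous_snd).mul (hw.comp
      ((continuous_fst.fst).prodMk (continuous_fst.snd.sub continuous_snd)))
  exact this.stronglyMeasurable.integral_prod_right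

theorem measurable_eLpNorm_mult {w : ℝ → V → ℝ} (h : IsTest (Function.uncurry w))
    (m : 𝓢(V, ℂ)) {p : ℝ} (hp : 0 < p) :
    Measurable fun t => eLpNorm (mult m (h.slice t).toS) (ENNReal.ofReal p) volume := by
  simp only [eLpNorm_ofReal_eq hp]
  exact ((stronglyMeasurable_mult h m).measurable.enorm.pow_const p).lintegral_prod_right'.pow_const _

theorem measurable_besov {w : ℝ → V → ℝ} (h : IsTest (Function.uncurry w)) (χ : LPF V) (s : ℝ)
    {p : ℝ} (hp : 0 < p) : Measurable fun t => besov χ s p fun y => (w t y : ℂ) := by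
  have : ∀ t, besov χ s p (fun y => (w t y : ℂ)) = besov χ s p (h.slice t).toS := fun t => rfl
  simp only [this, besov_coe]
  exact Measurable.tsum fun k => (measurable_eLpNorm_mult h _ hp).const_mul _

theorem enorm_mult_integral_le {w : ℝ → V → ℝ} (h : IsTest (Function.uncurry w))
    (m : 𝓢(V, ℂ)) (μ : Measure ℝ) [IsFiniteMeasure μ] (x : V) :
    ‖mult m (h.integral μ).toS x‖ₑ ≤ ∫⁻ τ, ‖mult m (h.slice τ).toS x‖ₑ ∂μ := by
  obtain ⟨M, hM⟩ := h.exists_bound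
  have hw : Continuous fun q : ℝ × V => (w q.1 q.2 : ℂ) :=
    Complex.continuous_ofReal.comp h.smooth.continuous
  have hint : Integrable (Function.uncurry fun z τ => (𝓕⁻ m) z * (w τ (x - z) : ℂ))
      ((volume : Measure V).prod μ) := by
    refine Integrable.mul_bdd (c := M) ((𝓕⁻ m).integrable.comp_fst μ)
      (hw.comp (continuous_snd.prodMk (continuous_const.sub continuous_fst))).aestronglyMeasurable
      (Filter.Eventually.of_forall fun q => ?_)
    simpa using hM (q.2, x - q.1)
  have e : mult m (h.integral μ).toS x = ∫ τ, mult m (h.slice τ).toS x ∂μ := by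
    simp only [mult_apply, IsTest.toS_apply]
    rw [← integral_integral_swap hint]
    refine integral_congr_ae (Filter.Eventually.of_forall fun z => ?_)
    simp only
    rw [integral_const_mul, integral_complex_ofReal]
  rw [e]
  exact enorm_integral_le_lintegral_enorm _

theorem besov_integral_le {w : ℝ → V → ℝ} (h : IsTest (Function.uncurry w)) (χ : LPF V) (s : ℝ)
    {p : ℝ} (hp : 1 < p) (μ : Measure ℝ) [IsFiniteMeasure μ] :
    besov χ s p (fun y => ((∫ τ, w τ y ∂μ : ℝ) : ℂ)) ≤
      ∫⁻ τ, besov χ s p (fun y => (w τ y : ℂ)) ∂μ := by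
  have h1 : ∀ t, besov χ s p (fun y => (w t y : ℂ)) = besov χ s p (h.slice t).toS := fun t => rfl
  have h2 : besov χ s p (fun y => ((∫ τ, w τ y ∂μ : ℝ) : ℂ)) =
    besov χ s p (h.integral μ).toS := rfl
  simp only [h1, h2, besov_coe, LPF.lp]
  rw [lintegral_tsum fun k =>
    ((measurable_eLpNorm_mult h _ (by linarith)).const_mul _).aemeasurable]
  refine ENNReal.tsum_le_tsum fun k => ?_
  rw [lintegral_const_mul _ (measurable_eLpNorm_mult h _ (by linarith))]
  gcongr
  exact eLpNorm_le_lintegral_eLpNorm hp (stronglyMeasurable_mult h _).measurable.enorm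
    fun y => enorm_mult_integral_le h _ μ y

end Time

end MHD

namespace MHD

open FourierTransform SchwartzMap LineDeriv

set_option linter.unusedSectionVars false

section TestAlgebra

variable {E : Type*} [NormedAddCommGroup E] [NormedSpace ℝ E]

theorem IsTest.mul {f g : E → ℝ} (hf : IsTest f) (hg : IsTest g) : IsTest fun y => f y * g y :=
  ⟨hf.smooth.mul hg.smooth, hf.cpt.mul_right⟩

theorem IsTest.const_mul (c : ℝ) {f : E → ℝ} (hf : IsTest f) : IsTest fun y => c * f y :=
  ⟨contDiff_const.mul hf.smooth, hf.cpt.mul_left⟩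

theorem IsTest.sum {ι : Type*} (s : Finset ι) {f : ι → E → ℝ} (hf : ∀ i ∈ s, IsTest (f i)) :
    IsTest fun y => ∑ i ∈ s, f i y where
  smooth := ContDiff.sum fun i hi => (hf i hi).smooth
  cpt := HasCompactSupport.intro (s.finite_toSet.isCompact_biUnion
      fun i hi => (hf i hi).cpt.isCompact) fun y hy => by
    simp only [Set.mem_iUnion, not_exists] at hy
    exact Finset.sum_eq_zero fun i hi => image_eq_zero_of_notMem_tsupport (hy i hi)

end TestAlgebra

section Algebra

variable {V : Type*} [NormedAddCommGroup V] [InnerProductSpace ℝ V]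
    [FiniteDimensional ℝ V] [MeasurableSpace V] [BorelSpace V]

theorem IsTest.lineDeriv_toS {f : V → ℝ} (h : IsTest f) (v : V) :
    (∂_{v} h.toS : 𝓢(V, ℂ)) = (h.fderiv_apply v).toS := by
  ext y
  rw [lineDerivOp_apply_eq_fderiv, h.toS_coe, IsTest.toS_apply]
  have := Complex.ofRealCLM.hasFDerivAt.comp y (h.smooth.differentiable (by simp) y).hasFDerivAt
  rw [show (fun y => (f y : ℂ)) = Complex.ofRealCLM ∘ f from rfl, this.fderiv]
  rfl

/-- The norm of real functions in the Besov algebra of regularity `d / p`. -/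
def algNorm (χ : LPF V) (p : ℝ) (f : V → ℝ) : ℝ≥0∞ :=
  besov χ (Module.finrank ℝ V / p) p fun y => (f y : ℂ)

theorem besov_sum_le (χ : LPF V) (s : ℝ) {p : ℝ} (hp : 1 ≤ p) {ι : Type*} (t : Finset ι)
    (f : ι → 𝓢(V, ℂ)) : besov χ s p (∑ i ∈ t, f i : 𝓢(V, ℂ)) ≤ ∑ i ∈ t, besov χ s p (f i) := by
  simp only [besov_coe]
  rw [← Summable.tsum_finsetSum fun _ _ => ENNReal.summable]
  refine ENNReal.tsum_le_tsum fun k => ?_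
  rw [← Finset.mul_sum, LPF.lp, mult_sum]
  gcongr
  exact eLpNorm_sum_coe_le hp _ _

theorem algNorm_sum_le (χ : LPF V) {p : ℝ} (hp : 1 ≤ p) {ι : Type*} (t : Finset ι)
    {f : ι → V → ℝ} (hf : ∀ i ∈ t, IsTest (f i)) :
    algNorm χ p (fun y => ∑ i ∈ t, f i y) ≤ ∑ i ∈ t, algNorm χ p (f i) := by
  have h := besov_sum_le χ (Module.finrank ℝ V / p) hp t.attach fun i => (hf i i.2).toS
  rw [← Finset.sum_attach t]
  refine Eq.trans_le ?_ h
  rw [algNorm, sum_coe]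
  congr 1
  ext y
  simp only [Finset.sum_apply, IsTest.toS_apply]
  rw [← Finset.sum_attach t]
  push_cast
  rfl

theorem algNorm_const_mul (χ : LPF V) (p c : ℝ) {f : V → ℝ} (hf : IsTest f) :
    algNorm χ p (fun y => c * f y) = ‖c‖ₑ * algNorm χ p f := by
  have h1 : (fun y => ((c * f y : ℝ) : ℂ)) = ((c : ℂ) • hf.toS : 𝓢(V, ℂ)) := by
    ext y
    simp [IsTest.toS_apply]
  have h2 : ∀ k, χ.lp k ((c : ℂ) • hf.toS) = (c : ℂ) • χ.lp k hf.toS := fun k =>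
    map_smul (fourierMultiplierCLM ℂ (dil k χ.band : V → ℂ)) _ _
  rw [algNorm, algNorm, h1, ← hf.toS_coe, besov_coe, besov_coe, ← ENNReal.tsum_mul_left]
  refine tsum_congr fun k => ?_
  rw [h2, smul_coe, eLpNorm_const_smul, mul_left_comm]
  congr 1
  rw [← ofReal_norm, ← ofReal_norm, Complex.norm_real]

theorem exists_algNorm_mul_le [Nontrivial V] (χ : LPF V) {p : ℝ} (hp : 1 < p) :
    ∃ K : ℝ≥0∞, K ≠ ∞ ∧ 1 ≤ K ∧ ∀ f g : V → ℝ, IsTest f → IsTest g →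
      algNorm χ p (fun y => f y * g y) ≤ K * (algNorm χ p f * algNorm χ p g) := by
  obtain ⟨C, hC, h⟩ := χ.exists_besov_prd_le hp
  refine ⟨C + 1, by simp [hC], by simp, fun f g hf hg => ?_⟩
  have h1 : (fun y => ((f y * g y : ℝ) : ℂ)) = prd hf.toS hg.toS := by
    ext y
    simp [prd_apply, IsTest.toS_apply]
  rw [algNorm, h1]
  refine (h _ _).trans ?_
  gcongr
  · simp
  · exact le_rfl
  · exact le_rfl

/-- Multiplication by `g` maps test functions to test functions, with operator norm at most `A`
for the Besov algebra norm. -/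
def IsMultiplier (χ : LPF V) (p : ℝ) (g : V → ℝ) (A : ℝ≥0∞) : Prop :=
  ∀ w : V → ℝ, IsTest w →
    IsTest (fun y => g y * w y) ∧ algNorm χ p (fun y => g y * w y) ≤ A * algNorm χ p w

theorem IsMultiplier.mul {χ : LPF V} {p : ℝ} {g g' : V → ℝ} {A A' : ℝ≥0∞}
    (h : IsMultiplier χ p g A) (h' : IsMultiplier χ p g' A') :
    IsMultiplier χ p (fun y => g y * g' y) (A * A') := fun w hw => by
  obtain ⟨h1, h2⟩ := h' w hw
  obtain ⟨h3, h4⟩ := h _ h1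
  simp only [mul_assoc]
  exact ⟨h3, h4.trans (by gcongr)⟩

theorem isMultiplier_one (χ : LPF V) (p : ℝ) : IsMultiplier χ p (fun _ => 1) 1 := fun w hw => by
  simpa using hw

theorem IsMultiplier.pow {χ : LPF V} {p : ℝ} {g : V → ℝ} {A : ℝ≥0∞} (h : IsMultiplier χ p g A)
    (n : ℕ) : IsMultiplier χ p (fun y => g y ^ n) (A ^ n) := by
  induction n with
  | zero => simpa using isMultiplier_one χ p
  | succ n ih => simpa only [pow_succ] using ih.mul h

theorem IsMultiplier.prod {χ : LPF V} {p : ℝ} {ι : Type*} (s : Finset ι) {g : ι → V → ℝ}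
    {A : ι → ℝ≥0∞} (h : ∀ i, IsMultiplier χ p (g i) (A i)) :
    IsMultiplier χ p (fun y => ∏ i ∈ s, g i y) (∏ i ∈ s, A i) := by
  classical
  induction s using Finset.induction_on with
  | empty => simpa using isMultiplier_one χ p
  | insert i s hi ih => simpa only [Finset.prod_insert hi] using (h i).mul ih

/-- A polynomial without constant term and of degree less than `n`, evaluated at elements of
the Besov algebra, acts by multiplication. -/
theorem exists_algNorm_eval_mul_le [Nontrivial V] (χ : LPF V) {p : ℝ} (hp : 1 < p)
    {ι : Type*} [Fintype ι] {n : ℕ} {q : MvPolynomial ι ℝ} (hq : MvPolynomial.constantCoeff q = 0)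
    (hdeg : q.totalDegree + 1 ≤ n) :
    ∃ K : ℝ≥0∞, K ≠ ∞ ∧ ∀ (X : ℝ≥0∞) (M : ι → V → ℝ), (∀ v, IsTest (M v)) →
      (∀ v, algNorm χ p (M v) ≤ X) →
        IsMultiplier χ p (fun y => MvPolynomial.eval (fun v => M v y) q)
          (K * ∑ r ∈ Finset.Icc 2 n, X ^ (r - 1)) := by
  obtain ⟨K, hK, hK1, hmul⟩ := exists_algNorm_mul_le χ hp
  refine ⟨(∑ d ∈ q.support, ‖q.coeff d‖ₑ) * K ^ n,
    ENNReal.mul_ne_top (ENNReal.sum_ne_top.mpr fun d _ => by simp) (ENNReal.pow_ne_top hK),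
    fun X M hM hX w hw => ?_⟩
  have hMv : ∀ v, IsMultiplier χ p (M v) (K * X) := fun v w hw => by
    refine ⟨(hM v).mul hw, (hmul _ _ (hM v) hw).trans ?_⟩
    rw [mul_assoc]
    gcongr
    exact hX v
  have hmon : ∀ d : ι →₀ ℕ, IsMultiplier χ p (fun y => ∏ v, M v y ^ d v) (∏ v, (K * X) ^ d v) :=
    fun d => IsMultiplier.prod _ fun v => (hMv v).pow _
  have e : (fun y => MvPolynomial.eval (fun v => M v y) q * w y) =
      fun y => ∑ d ∈ q.support, q.coeff d * ((∏ v, M v y ^ d v) * w y) := by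
    ext y
    rw [MvPolynomial.eval_eq', Finset.sum_mul]
    simp only [mul_assoc]
  have ht : ∀ d ∈ q.support, IsTest fun y => q.coeff d * ((∏ v, M v y ^ d v) * w y) :=
    fun d _ => (hmon d w hw).1.const_mul _
  rw [e]
  refine ⟨IsTest.sum _ ht, (algNorm_sum_le χ hp.le _ ht).trans ?_⟩
  rw [Finset.sum_mul, Finset.sum_mul, Finset.sum_mul]
  refine Finset.sum_le_sum fun d hd => ?_
  rw [algNorm_const_mul _ _ _ (hmon d w hw).1, mul_assoc, mul_assoc]
  gcongr
  refine (hmon d w hw).2.trans ?_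
  rw [← mul_assoc]
  gcongr
  have hd1 : ∑ v, d v + 1 ≤ n := by
    have := MvPolynomial.le_totalDegree hd
    rw [Finsupp.sum_fintype _ _ (by simp)] at this
    omega
  have hd0 : 1 ≤ ∑ v, d v := by
    by_contra h0
    have h0 : ∀ v, d v = 0 := by simpa using h0
    have : d = 0 := Finsupp.ext h0
    rw [MvPolynomial.mem_support_iff, this] at hd
    exact hd hq
  rw [Finset.prod_pow_eq_pow_sum, mul_pow]
  refine mul_le_mul' (pow_le_pow_right₀ hK1 (by omega)) ?_
  have := Finset.single_le_sum (f := fun r => X ^ (r - 1)) (fun _ _ => zero_le)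
    (Finset.mem_Icc.mpr ⟨by omega, hd1⟩ : ∑ v, d v + 1 ∈ Finset.Icc 2 n)
  simpa using this

end Algebra

theorem totalDegree_cofactor_le {N : ℕ} {Q : Fin N → Fin N → MvPolynomial (Fin N × Fin N) ℝ}
    (hQ : IsCofactorPoly N Q) (i j : Fin N) : (Q i j).totalDegree ≤ N - 1 := by
  let X : Matrix (Fin N) (Fin N) (MvPolynomial (Fin N × Fin N) ℝ) :=
    Matrix.of fun a b => MvPolynomial.X (a, b)
  have e : Q i j = (1 + X).adjugate i j - MvPolynomial.C (if i = j then 1 else 0) := by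
    refine MvPolynomial.funext fun x => ?_
    have h1 := (hQ i j).2 (Matrix.of fun a b => x (a, b))
    have h2 := congrFun₂ (RingHom.map_adjugate (MvPolynomial.eval x) (1 + X)) i j
    have h3 : (MvPolynomial.eval x).mapMatrix (1 + X) = 1 + Matrix.of fun a b => x (a, b) := by
      rw [map_add, map_one]
      congr 1
      ext a b
      simp [X]
    rw [h3, h1] at h2
    rw [map_sub, MvPolynomial.eval_C]
    rw [RingHom.mapMatrix_apply, Matrix.map_apply] at h2
    rw [h2]
    simp
  have hone : ∀ a b, ((1 + X) a b).totalDegree ≤ 1 := fun a b => by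
    rw [Matrix.add_apply]
    refine (MvPolynomial.totalDegree_add _ _).trans (max_le ?_ ?_)
    · rw [Matrix.one_apply]
      split_ifs <;> simp
    · simp [X]
  rw [e]
  refine (MvPolynomial.totalDegree_sub _ _).trans (max_le ?_ (by rw [MvPolynomial.totalDegree_C]; simp))
  rw [Matrix.adjugate_apply, Matrix.det_apply]
  refine MvPolynomial.totalDegree_finsetSum_le fun σ _ => ?_
  refine (MvPolynomial.totalDegree_smul_le _ _).trans ?_
  refine (MvPolynomial.totalDegree_finsetProd _ _).trans ?_
  have hle : ∀ k, ((1 + X).updateRow j (Pi.single i 1) (σ k) k).totalDegree ≤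
      if k = σ.symm j then 0 else 1 := fun k => by
    split_ifs with h
    · rw [h, Equiv.apply_symm_apply, Matrix.updateRow_self, Pi.single_apply]
      split_ifs <;> simp
    · rw [Matrix.updateRow_ne (fun h' => h (by simp [← h']))]
      exact hone _ _
  refine (Finset.sum_le_sum fun k _ => hle k).trans ?_
  rw [Finset.sum_ite]
  simp [Finset.filter_ne', Finset.card_erase_of_mem]

end MHD

namespace MHD

open LineDeriv

theorem IsTest.coe_pdv {n : ℕ} {f : Euc n → ℝ} (h : IsTest f) (i : Fin n) :
    (fun y => ((pdv i f y : ℝ) : ℂ)) =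
      (∂_{(EuclideanSpace.single i 1 : Euc n)} h.toS : SchwartzMap (Euc n) ℂ) := by
  rw [h.lineDeriv_toS]
  rfl

theorem exists_besov_pdv_le {n : ℕ} (χ : LPF (Euc n)) {p : ℝ} (hp : 1 < p) :
    ∃ C : ℝ≥0∞, C ≠ ∞ ∧ ∀ (f : Euc n → ℝ), IsTest f → ∀ i,
      besov χ (-1 + n / p) p (fun y => ((pdv i f y : ℝ) : ℂ)) ≤ C * algNorm χ p f := by
  let c : Fin n → ℝ≥0∞ := fun i =>
    ∫⁻ z, ‖FourierTransformInv.fourierInv (χ.derivSymbol (EuclideanSpace.single i 1)) z‖ₑ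
  have hc : ∀ i, c i ≠ ∞ := fun i => (lintegral_enorm_lt_top _).ne
  refine ⟨∑ i, c i, by simp [hc], fun f hf i => ?_⟩
  rw [hf.coe_pdv, algNorm, finrank_euclideanSpace_fin]
  refine (besov_lineDeriv_le χ hp _ _ _).trans ?_
  exact mul_le_mul' (Finset.single_le_sum (f := c) (fun _ _ => zero_le) (Finset.mem_univ i)) le_rfl

theorem exists_algNorm_le_pdv {n : ℕ} (χ : LPF (Euc n)) {p : ℝ} (hp : 1 < p) :
    ∃ D : ℝ≥0∞, D ≠ ∞ ∧ 1 ≤ D ∧ ∀ (f : Euc n → ℝ), IsTest f →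
      algNorm χ p f ≤ D * ∑ i, besov χ (-1 + n / p) p (fun y => ((pdv i f y : ℝ) : ℂ)) := by
  let c : Fin n → ℝ≥0∞ := fun i =>
    ∫⁻ z, ‖FourierTransformInv.fourierInv (χ.gradInvSymbol (EuclideanSpace.single i 1)) z‖ₑ
  have hc : ∀ i, c i ≠ ∞ := fun i => (lintegral_enorm_lt_top _).ne
  refine ⟨∑ i, c i + 1, by simp [hc], by simp, fun f hf => ?_⟩
  have h := besov_le_sum_lineDeriv χ hp (n / p) hf.toS
  rw [algNorm, finrank_euclideanSpace_fin, Finset.mul_sum]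
  refine h.trans (Finset.sum_le_sum fun i _ => ?_)
  rw [hf.coe_pdv]
  gcongr
  exact (Finset.single_le_sum (f := c) (fun _ _ => zero_le) (Finset.mem_univ i)).trans
    le_self_add

section Velocity

variable {N : ℕ} {u : ℝ → Euc N → Euc N}

theorem SmoothCpt.isTest_comp (hu : SmoothCpt N u) (m : Fin N) :
    IsTest (Function.uncurry fun t y => u t y m) where
  smooth := (EuclideanSpace.proj (𝕜 := ℝ) m : Euc N →L[ℝ] ℝ).contDiff.comp hu.1
  cpt := hu.2.1.comp_left (g := fun x : Euc N => x m) rfl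

/-- The space-time field `∂_{v.2} u_{v.1}`. -/
def grad (u : ℝ → Euc N → Euc N) (v : Fin N × Fin N) (t : ℝ) (y : Euc N) : ℝ :=
  pdv v.2 (fun z => u t z v.1) y

theorem SmoothCpt.isTest_grad (hu : SmoothCpt N u) (v : Fin N × Fin N) :
    IsTest (Function.uncurry (grad u v)) :=
  (hu.isTest_comp v.1).fderiv_uncurry _

theorem exists_sum_lintegral_grad_le (χ : LPF (Euc N)) {p : ℝ} (hp : 1 < p) :
    ∃ D : ℝ≥0∞, D ≠ ∞ ∧ 1 ≤ D ∧ ∀ u : ℝ → Euc N → Euc N, SmoothCpt N u →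
      ∑ v, ∫⁻ t in Set.Ioi 0, algNorm χ p (grad u v t) ≤ D * EE χ (-1 + N / p) p u := by
  obtain ⟨D, hD, hD1, h⟩ := exists_algNorm_le_pdv χ hp
  refine ⟨D, hD, hD1, fun u hu => ?_⟩
  have hm : ∀ v i, Measurable fun t =>
      besov χ (-1 + N / p) p fun y => ((pdv i (grad u v t) y : ℝ) : ℂ) := fun v i =>
    measurable_besov ((hu.isTest_grad v).fderiv_uncurry (EuclideanSpace.single i 1)) χ _
      (by linarith)
  calc ∑ v, ∫⁻ t in Set.Ioi 0, algNorm χ p (grad u v t)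
      ≤ ∑ v, ∫⁻ t in Set.Ioi 0,
          D * ∑ i, besov χ (-1 + N / p) p (fun y => ((pdv i (grad u v t) y : ℝ) : ℂ)) := by
        gcongr with v _ t
        exact h _ ((hu.isTest_grad v).slice t)
    _ = D * ∑ v, ∑ i, ∫⁻ t in Set.Ioi 0,
          besov χ (-1 + N / p) p (fun y => ((pdv i (grad u v t) y : ℝ) : ℂ)) := by
        rw [Finset.mul_sum]
        refine Finset.sum_congr rfl fun v _ => ?_
        rw [lintegral_const_mul' _ _ hD, lintegral_finsetSum _ fun i _ => hm v i]
    _ = D * EE χ (-1 + N / p) p u := by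
        rw [EE, Fintype.sum_prod_type]
        refine congrArg (D * ·) (Finset.sum_congr rfl fun m _ => Finset.sum_comm.trans ?_)
        exact Finset.sum_congr rfl fun i _ => Finset.sum_congr rfl fun j _ => rfl

theorem SmoothCpt.Pmat_eq (Q : Fin N → Fin N → MvPolynomial (Fin N × Fin N) ℝ) {t : ℝ}
    (ht : 0 ≤ t) (y : Euc N) (i j : Fin N) : Pmat Q u t y i j =
      MvPolynomial.eval (fun v => ∫ τ in Set.Ioc 0 t, grad u v τ y) (Q i j) := by
  simp only [Pmat, intervalIntegral.integral_of_le ht]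
  rfl

theorem SmoothCpt.algNorm_integral_grad_le (hu : SmoothCpt N u) (χ : LPF (Euc N)) {p : ℝ}
    (hp : 1 < p) (t : ℝ) (v : Fin N × Fin N) :
    algNorm χ p (fun y => ∫ τ in Set.Ioc 0 t, grad u v τ y) ≤
      ∑ v, ∫⁻ t in Set.Ioi 0, algNorm χ p (grad u v t) := by
  refine (besov_integral_le (hu.isTest_grad v) χ _ hp _).trans ?_
  refine le_trans ?_ (Finset.single_le_sum
    (f := fun v => ∫⁻ t in Set.Ioi 0, algNorm χ p (grad u v t)) (fun _ _ => zero_le)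
    (Finset.mem_univ v))
  exact lintegral_mono_set Set.Ioc_subset_Ioi_self

/-- The divergence correction is controlled pointwise in time in the Besov algebra. -/
theorem exists_algNorm_correction_le (hN : 2 ≤ N) (χ : LPF (Euc N)) {p : ℝ} (hp : 1 < p)
    {Q : Fin N → Fin N → MvPolynomial (Fin N × Fin N) ℝ} (hQ : IsCofactorPoly N Q) :
    ∃ K : ℝ≥0∞, K ≠ ∞ ∧ ∀ u : ℝ → Euc N → Euc N, SmoothCpt N u → ∀ t, 0 < t →
      IsTest (fun z => ∑ i : Fin N, ∑ j : Fin N,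
        Pmat Q u t z j i * pdv j (fun z' => u t z' i) z) ∧
      algNorm χ p (fun z => ∑ i : Fin N, ∑ j : Fin N,
        Pmat Q u t z j i * pdv j (fun z' => u t z' i) z) ≤
      K * (∑ r ∈ Finset.Icc 2 N,
        (∑ v, ∫⁻ t in Set.Ioi 0, algNorm χ p (grad u v t)) ^ (r - 1)) *
          ∑ v, algNorm χ p (grad u v t) := by
  have : Nonempty (Fin N) := ⟨⟨0, by omega⟩⟩
  have h : ∀ v : Fin N × Fin N, _ := fun v => exists_algNorm_eval_mul_le χ hp (n := N)
    (hQ v.2 v.1).1 (by have := totalDegree_cofactor_le hQ v.2 v.1; omega)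
  choose K hK h using h
  refine ⟨∑ v, K v, ENNReal.sum_ne_top.mpr fun v _ => hK v, fun u hu t ht => ?_⟩
  have e : (fun z => ∑ i : Fin N, ∑ j : Fin N,
      Pmat Q u t z j i * pdv j (fun z' => u t z' i) z) = fun z => ∑ v : Fin N × Fin N,
      MvPolynomial.eval (fun v' => ∫ τ in Set.Ioc 0 t, grad u v' τ z) (Q v.2 v.1) *
        grad u v t z := by
    ext z
    simp only [Fintype.sum_prod_type, SmoothCpt.Pmat_eq Q ht.le]
    rfl
  have hv := fun v => h v _ (fun v' y => ∫ τ in Set.Ioc 0 t, grad u v' τ y)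
    (fun v' => (hu.isTest_grad v').integral _) (hu.algNorm_integral_grad_le χ hp t) (grad u v t)
    ((hu.isTest_grad v).slice t)
  rw [e]
  refine ⟨IsTest.sum _ fun v _ => (hv v).1,
    (algNorm_sum_le χ hp.le _ fun v _ => (hv v).1).trans ?_⟩
  rw [Finset.mul_sum]
  refine Finset.sum_le_sum fun v _ => (hv v).2.trans ?_
  gcongr
  exact Finset.single_le_sum (f := K) (fun _ _ => zero_le) (Finset.mem_univ v)

end Velocity

end MHD

/-- **estimate (3.14).** For `N ≤ p < 2N − 1`,
`‖∇V₅(u)‖_{L¹(ℝ₊;Ḃ^{−1+N/p}_{p,1})} ≤ C ∑_{r=2}^{N} E(u)^r`, where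
`V₅(u) = ∑_{i,j} P_{ji} ∂_j u_i`. -/
theorem V5_gradient_estimate
    (N : ℕ) (hN : 2 ≤ N) (p : ℝ) (hp1 : (N : ℝ) ≤ p) (hp2 : p < 2 * N - 1)
    (χ : LPF (Euc N))
    (Q : Fin N → Fin N → MvPolynomial (Fin N × Fin N) ℝ) (hQ : IsCofactorPoly N Q) :
    ∃ C : ℝ, 0 < C ∧
      ∀ u : ℝ → Euc N → Euc N, SmoothCpt N u →
        (∑ ℓ : Fin N, besovT χ (-1 + N / p) p (Set.Ioi 0) (fun t y =>
          ((pdv ℓ (fun z => ∑ i : Fin N, ∑ j : Fin N,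
              Pmat Q u t z j i * pdv j (fun z' => u t z' i) z) y : ℝ) : ℂ))) ≤
        ENNReal.ofReal C *
          ∑ r ∈ Finset.Icc 2 N, EE χ (-1 + N / p) p u ^ r := by
  have hp : 1 < p := by
    have : (2 : ℝ) ≤ N := by exact_mod_cast hN
    linarith
  obtain ⟨C, hC, hgrad⟩ := exists_besov_pdv_le χ hp
  obtain ⟨K, hK, hV⟩ := exists_algNorm_correction_le hN χ hp hQ
  obtain ⟨D, hD, hD1, hE⟩ := exists_sum_lintegral_grad_le χ hp
  have hT : C * K * N * D ^ N ≠ ∞ := ENNReal.mul_ne_top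
    (ENNReal.mul_ne_top (ENNReal.mul_ne_top hC hK) (by simp)) (ENNReal.pow_ne_top hD)
  refine ⟨(C * K * N * D ^ N).toReal + 1, by positivity, fun u hu => ?_⟩
  set Z := ∑ v, ∫⁻ t in Set.Ioi 0, algNorm χ p (grad u v t) with hZ
  set S := ∑ r ∈ Finset.Icc 2 N, Z ^ (r - 1) with hS
  have hm : ∀ v, Measurable fun t => algNorm χ p (grad u v t) := fun v =>
    measurable_besov (hu.isTest_grad v) χ _ (by linarith)
  have hℓ : ∀ ℓ : Fin N, besovT χ (-1 + N / p) p (Set.Ioi 0) (fun t y =>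
      ((pdv ℓ (fun z => ∑ i : Fin N, ∑ j : Fin N,
        Pmat Q u t z j i * pdv j (fun z' => u t z' i) z) y : ℝ) : ℂ)) ≤ C * K * (S * Z) :=
    fun ℓ => by
    calc _ ≤ ∫⁻ t in Set.Ioi 0, C * K * S * ∑ v, algNorm χ p (grad u v t) := by
          refine setLIntegral_mono' measurableSet_Ioi fun t ht => ?_
          obtain ⟨h1, h2⟩ := hV u hu t ht
          refine (hgrad _ h1 ℓ).trans ?_
          rw [mul_assoc C, mul_assoc C]
          gcongr
      _ = C * K * (S * Z) := by
          rw [lintegral_const_mul _ (Finset.measurable_sum _ fun v _ => hm v),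
            lintegral_finsetSum _ fun v _ => hm v, mul_assoc]
  have hSZ : S * Z ≤ D ^ N * ∑ r ∈ Finset.Icc 2 N, EE χ (-1 + N / p) p u ^ r := by
    rw [hS, Finset.sum_mul, Finset.mul_sum]
    refine Finset.sum_le_sum fun r hr => ?_
    rw [Finset.mem_Icc] at hr
    calc Z ^ (r - 1) * Z = Z ^ r := by rw [← pow_succ]; congr 1; omega
      _ ≤ (D * EE χ (-1 + N / p) p u) ^ r := by gcongr; exact hE u hu
      _ ≤ D ^ N * EE χ (-1 + N / p) p u ^ r := by
          rw [mul_pow]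
          exact mul_le_mul' (pow_le_pow_right₀ hD1 hr.2) le_rfl
  calc _ ≤ ∑ ℓ : Fin N, C * K * (S * Z) := Finset.sum_le_sum fun ℓ _ => hℓ ℓ
    _ = C * K * N * (S * Z) := by
        rw [Finset.sum_const, Finset.card_univ, Fintype.card_fin, nsmul_eq_mul]; ring
    _ ≤ C * K * N * (D ^ N * ∑ r ∈ Finset.Icc 2 N, EE χ (-1 + N / p) p u ^ r) := by gcongr
    _ = ENNReal.ofReal (C * K * N * D ^ N).toReal *
          ∑ r ∈ Finset.Icc 2 N, EE χ (-1 + N / p) p u ^ r := by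
        rw [ENNReal.ofReal_toReal hT, mul_assoc (C * K * N)]
    _ ≤ _ := by gcongr; simp
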